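/- arXiv:1807.11609 — 5 statements merged into one kernel-verified Lean document; each statement's English description precedes it below -/
import Mathlib

section
/- Fix a positive integer m and a binary string x ∈ {0,1}^m. For every natural number r, the r-th moment of the normalized occurrence count converges to the corresponding moment of the standard normal distribution: lim_{n→∞} E[((Ω_n(x) − E[Ω_n(x)])/√(Var[Ω_n(x)]))^r] equals 0 if r is odd, and equals the double factorial (r−1)·(r−3)·…·1 if r is even (and equals 1 for r = 0). -/
open Filter Asymptotics

/-- `ω_x(y)`: the number of ways the string `x` of length `m` can be embedded as a
subsequence of the string `y` of length `n`, i.e. the number of strictly increasing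
index maps `π : Fin m → Fin n` with `y ∘ π = x`. -/
noncomputable def omega {m n : ℕ} (x : Fin m → Bool) (y : Fin n → Bool) : ℕ :=
  Nat.card {π : Fin m → Fin n // StrictMono π ∧ ∀ j, y (π j) = x j}

/-- Expectation of `f` under the uniform distribution on `{0,1}^n`. -/
noncomputable def expectUnif (n : ℕ) (f : (Fin n → Bool) → ℝ) : ℝ :=
  (∑ y : Fin n → Bool, f y) / 2 ^ n

/-- Variance of `f` under the uniform distribution on `{0,1}^n`. -/
noncomputable def varUnif (n : ℕ) (f : (Fin n → Bool) → ℝ) : ℝ :=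
  expectUnif n (fun y => (f y - expectUnif n f) ^ 2)

lemma expectUnif_add (n : ℕ) (f g : (Fin n → Bool) → ℝ) :
    expectUnif n (fun y => f y + g y) = expectUnif n f + expectUnif n g := by
  simp only [expectUnif, Finset.sum_add_distrib, add_div]

lemma expectUnif_sub (n : ℕ) (f g : (Fin n → Bool) → ℝ) :
    expectUnif n (fun y => f y - g y) = expectUnif n f - expectUnif n g := by
  simp only [expectUnif, Finset.sum_sub_distrib, sub_div]

lemma expectUnif_const_mul (n : ℕ) (c : ℝ) (f : (Fin n → Bool) → ℝ) :
    expectUnif n (fun y => c * f y) = c * expectUnif n f := by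
  simp only [expectUnif, ← Finset.mul_sum, mul_div_assoc]

lemma expectUnif_mul_const (n : ℕ) (c : ℝ) (f : (Fin n → Bool) → ℝ) :
    expectUnif n (fun y => f y * c) = expectUnif n f * c := by
  simp only [mul_comm _ c, expectUnif_const_mul]

lemma expectUnif_const (n : ℕ) (c : ℝ) : expectUnif n (fun _ => c) = c := by
  simp [expectUnif]

lemma expectUnif_sum {ι : Type*} (n : ℕ) (S : Finset ι) (f : ι → (Fin n → Bool) → ℝ) :
    expectUnif n (fun y => ∑ i ∈ S, f i y) = ∑ i ∈ S, expectUnif n (f i) := by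
  simp only [expectUnif]
  rw [Finset.sum_comm, Finset.sum_div]

lemma expectUnif_mono (n : ℕ) {f g : (Fin n → Bool) → ℝ} (h : ∀ y, f y ≤ g y) :
    expectUnif n f ≤ expectUnif n g := by
  simp only [expectUnif]
  gcongr
  exact h _

lemma abs_expectUnif_le (n : ℕ) {f g : (Fin n → Bool) → ℝ} (h : ∀ y, |f y| ≤ g y) :
    |expectUnif n f| ≤ expectUnif n g := by
  rw [abs_le]
  constructor
  · have := expectUnif_mono n (f := fun y => (-1) * g y) (g := f)
      (fun y => by have := (abs_le.1 (h y)).1; linarith)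
    rw [expectUnif_const_mul] at this
    linarith
  · exact expectUnif_mono n fun y => (abs_le.1 (h y)).2

/-- Cauchy–Schwarz. -/
lemma expectUnif_mul_sq_le (n : ℕ) (f g : (Fin n → Bool) → ℝ) :
    expectUnif n (fun y => f y * g y) ^ 2 ≤
      expectUnif n (fun y => f y ^ 2) * expectUnif n (fun y => g y ^ 2) := by
  simp only [expectUnif]
  rw [div_pow, div_mul_div_comm, ← sq]
  gcongr
  exact Finset.sum_mul_sq_le_sq_mul_sq _ _ _

/-- Functions of disjoint sets of coordinates are independent. -/
lemma expectUnif_mul_of_dependsOn {n : ℕ} {f g : (Fin n → Bool) → ℝ} {A : Set (Fin n)}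
    (hf : DependsOn f A) (hg : DependsOn g Aᶜ) :
    expectUnif n (fun y => f y * g y) = expectUnif n f * expectUnif n g := by
  classical
  have key : ∑ p : (Fin n → Bool) × (Fin n → Bool), f p.1 * g p.2 =
      ∑ p : (Fin n → Bool) × (Fin n → Bool), f p.1 * g p.1 := by
    refine Finset.sum_bij' (fun p _ => (A.piecewise p.1 p.2, A.piecewise p.2 p.1))
      (fun p _ => (A.piecewise p.1 p.2, A.piecewise p.2 p.1)) (by simp) (by simp) ?_ ?_ ?_
    · rintro ⟨y, z⟩ -
      ext i <;> by_cases hi : i ∈ A <;> simp [hi]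
    · rintro ⟨y, z⟩ -
      ext i <;> by_cases hi : i ∈ A <;> simp [hi]
    · rintro ⟨y, z⟩ -
      congr 1
      · exact hf fun i hi => by simp [hi]
      · exact hg fun i hi => by
          have : i ∉ A := hi
          simp [this]
  rw [Fintype.sum_prod_type, Fintype.sum_prod_type] at key
  simp only [← Finset.mul_sum, ← Finset.sum_mul, Finset.sum_const, Finset.card_univ,
    Fintype.card_pi, Fintype.card_bool, Finset.prod_const, Fintype.card_fin, nsmul_eq_mul] at key
  simp only [expectUnif]
  simp only [mul_left_comm (f _), ← Finset.mul_sum] at key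
  rw [div_mul_div_comm, key]
  push_cast
  rw [mul_div_mul_left _ _ (by positivity)]

lemma DependsOn.mono_set {ι α β : Type*} {f : (ι → α) → β} {s t : Set ι} (h : DependsOn f s)
    (hst : s ⊆ t) : DependsOn f t :=
  fun _ _ hxy => h fun i hi => hxy i (hst hi)

lemma abs_pow_sub_sub_pow_le (q : ℕ) (w h : ℝ) :
    |w ^ (q + 1) - (w - h) ^ (q + 1)| ≤ (q + 1) * |h| * (|w| + |h|) ^ q := by
  have h1 := abs_pow_sub_pow_le w (w - h) (q + 1)
  refine h1.trans ?_
  have h2 : max |w| |w - h| ≤ |w| + |h| :=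
    max_le (by linarith [abs_nonneg h]) (abs_sub w h)
  have h3 : w - (w - h) = h := by ring
  rw [h3]
  push_cast
  have h4 : max |w| |w - h| ^ q ≤ (|w| + |h|) ^ q :=
    pow_le_pow_left₀ (le_max_of_le_left (abs_nonneg _)) h2 q
  calc _ ≤ |h| * (q + 1) * (|w| + |h|) ^ q := by gcongr
    _ = _ := by ring

/-- Second order Taylor estimate for the power function. -/
lemma abs_sub_pow_sub_taylor_le (q : ℕ) (w h : ℝ) :
    |w ^ (q + 2) - (w - h) ^ (q + 2) - (q + 2) * h * w ^ (q + 1)| ≤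
      (q + 2) ^ 2 * h ^ 2 * (|w| + |h|) ^ q := by
  induction q with
  | zero =>
    have : w ^ (0 + 2) - (w - h) ^ (0 + 2) - ((0 : ℕ) + 2) * h * w ^ (0 + 1) = - h ^ 2 := by
      push_cast; ring
    rw [this, abs_neg, abs_of_nonneg (sq_nonneg h)]
    push_cast
    nlinarith [sq_nonneg h]
  | succ q ih =>
    set R := w ^ (q + 2) - (w - h) ^ (q + 2) - (q + 2) * h * w ^ (q + 1) with hR
    have e : w ^ (q + 1 + 2) - (w - h) ^ (q + 1 + 2) - ((q + 1 : ℕ) + 2) * h * w ^ (q + 1 + 1)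
        = (w - h) * R - (q + 2) * h ^ 2 * w ^ (q + 1) := by
      rw [hR]; push_cast; ring
    rw [e]
    have hw : |w| ^ (q + 1) ≤ (|w| + |h|) ^ (q + 1) := by
      gcongr; linarith [abs_nonneg h]
    calc |(w - h) * R - (q + 2) * h ^ 2 * w ^ (q + 1)|
        ≤ |w - h| * |R| + (q + 2) * h ^ 2 * |w| ^ (q + 1) := by
          refine (abs_sub _ _).trans (le_of_eq ?_)
          rw [abs_mul, abs_mul, abs_pow, abs_of_nonneg (by positivity : (0:ℝ) ≤ (q + 2) * h ^ 2)]
      _ ≤ (|w| + |h|) * ((q + 2) ^ 2 * h ^ 2 * (|w| + |h|) ^ q) +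
          (q + 2) * h ^ 2 * (|w| + |h|) ^ (q + 1) := by
          gcongr
          exact abs_sub w h
      _ = ((q + 2) ^ 2 + (q + 2)) * (h ^ 2 * (|w| + |h|) ^ (q + 1)) := by ring
      _ ≤ ((q + 1 : ℕ) + 2) ^ 2 * (h ^ 2 * (|w| + |h|) ^ (q + 1)) := by
          gcongr
          push_cast
          nlinarith [Nat.cast_nonneg (α := ℝ) q]
      _ = _ := by ring

section LocalDependence

variable {n : ℕ} {ι : Type*}

open Classical in
/-- The indices in `S` whose coordinate set meets that of `i`. -/
noncomputable def neighbours (S : Finset ι) (supp : ι → Set (Fin n)) (i : ι) : Finset ι :=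
  {j ∈ S | ¬ Disjoint (supp i) (supp j)}

/-- A family of at most `N` centred functions bounded by `1`, each of which depends on a set of
coordinates meeting the coordinate sets of at most `D` members of the family. -/
structure IsLocallyDependent (S : Finset ι) (X : ι → (Fin n → Bool) → ℝ)
    (supp : ι → Set (Fin n)) (N D : ℝ) : Prop where
  dependsOn : ∀ i ∈ S, DependsOn (X i) (supp i)
  expect_eq_zero : ∀ i ∈ S, expectUnif n (X i) = 0
  abs_le_one : ∀ i ∈ S, ∀ y, |X i y| ≤ 1
  nonneg : 0 ≤ D
  card_le : (S.card : ℝ) ≤ N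
  card_neighbours_le : ∀ i ∈ S, ((neighbours S supp i).card : ℝ) ≤ D

open Classical in
lemma neighbours_subset (S : Finset ι) (supp : ι → Set (Fin n)) (i : ι) :
    neighbours S supp i ⊆ S :=
  Finset.filter_subset _ _

open Classical in
lemma disjoint_of_notMem_neighbours {S : Finset ι} {supp : ι → Set (Fin n)} {i j : ι}
    (hj : j ∈ S) (h : j ∉ neighbours S supp i) : Disjoint (supp i) (supp j) := by
  by_contra hd
  exact h (Finset.mem_filter.2 ⟨hj, hd⟩)

namespace IsLocallyDependent

variable {S : Finset ι} {X : ι → (Fin n → Bool) → ℝ} {supp : ι → Set (Fin n)} {N D : ℝ}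

lemma abs_sum_le (hX : IsLocallyDependent S X supp N D) {A : Finset ι} (hA : A ⊆ S)
    (y : Fin n → Bool) : |∑ i ∈ A, X i y| ≤ A.card := by
  refine (Finset.abs_sum_le_sum_abs _ _).trans ?_
  refine (Finset.sum_le_sum fun i hi => hX.abs_le_one i (hA hi) y).trans ?_
  simp

lemma expect_mul_pow_eq (hX : IsLocallyDependent S X supp N D) {A : Finset ι} (hA : A ⊆ S)
    {B : Set (Fin n)} (hB : ∀ j ∈ S, j ∉ A → Disjoint B (supp j)) {f : (Fin n → Bool) → ℝ}
    (hf : DependsOn f B) (p : ℕ) :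
    expectUnif n (fun y => f y * (∑ i ∈ S, X i y - ∑ i ∈ A, X i y) ^ p) =
      expectUnif n f * expectUnif n (fun y => (∑ i ∈ S, X i y - ∑ i ∈ A, X i y) ^ p) := by
  classical
  refine expectUnif_mul_of_dependsOn hf ?_
  intro y z hyz
  simp only
  congr 1
  rw [sub_eq_iff_eq_add.2 (Finset.sum_sdiff hA (f := fun i => X i y)).symm,
    sub_eq_iff_eq_add.2 (Finset.sum_sdiff hA (f := fun i => X i z)).symm]
  refine Finset.sum_congr rfl fun j hj => ?_
  rw [Finset.mem_sdiff] at hj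
  refine hX.dependsOn j hj.1 fun k hk => hyz k ?_
  exact fun hkB => Set.disjoint_left.1 (hB j hj.1 hj.2) hkB hk

lemma expect_mul_eq_zero (hX : IsLocallyDependent S X supp N D) {i j : ι} (hi : i ∈ S)
    (hj : j ∈ S) (h : j ∉ neighbours S supp i) : expectUnif n (fun y => X i y * X j y) = 0 := by
  rw [expectUnif_mul_of_dependsOn (hX.dependsOn i hi), hX.expect_eq_zero i hi, zero_mul]
  refine (hX.dependsOn j hj).mono_set ?_
  exact (disjoint_of_notMem_neighbours hj h).subset_compl_left

lemma expect_sq_eq (hX : IsLocallyDependent S X supp N D) :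
    expectUnif n (fun y => (∑ i ∈ S, X i y) ^ 2) =
      ∑ i ∈ S, ∑ j ∈ neighbours S supp i, expectUnif n (fun y => X i y * X j y) := by
  have h1 : ∀ y, (∑ i ∈ S, X i y) ^ 2 = ∑ i ∈ S, ∑ j ∈ S, X i y * X j y := fun y => by
    rw [sq, Finset.sum_mul_sum]
  simp only [h1]
  rw [expectUnif_sum]
  refine Finset.sum_congr rfl fun i hi => ?_
  rw [expectUnif_sum]
  symm
  exact Finset.sum_subset (neighbours_subset S supp i) fun j hj hn =>
    hX.expect_mul_eq_zero hi hj hn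

lemma abs_mul_le_one (hX : IsLocallyDependent S X supp N D) {i j : ι} (hi : i ∈ S)
    (hj : j ∈ S) (y : Fin n → Bool) : |X i y * X j y| ≤ 1 := by
  rw [abs_mul]
  exact mul_le_one₀ (hX.abs_le_one i hi y) (abs_nonneg _) (hX.abs_le_one j hj y)

lemma abs_expect_mul_le_one (hX : IsLocallyDependent S X supp N D) {i j : ι} (hi : i ∈ S)
    (hj : j ∈ S) : |expectUnif n (fun y => X i y * X j y)| ≤ 1 := by
  have := abs_expectUnif_le n (hX.abs_mul_le_one hi hj)
  rwa [expectUnif_const] at this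

lemma abs_sum_sum_le (hX : IsLocallyDependent S X supp N D) (F : ι → ι → ℝ) {c : ℝ} (hc : 0 ≤ c)
    (hF : ∀ i ∈ S, ∀ j ∈ S, |F i j| ≤ c) :
    |∑ i ∈ S, ∑ j ∈ neighbours S supp i, F i j| ≤ N * D * c := by
  have hD : ∀ i ∈ S, |∑ j ∈ neighbours S supp i, F i j| ≤ D * c := fun i hi => by
    refine (Finset.abs_sum_le_sum_abs _ _).trans ?_
    refine (Finset.sum_le_sum fun j hj => hF i hi j (neighbours_subset _ _ _ hj)).trans ?_
    rw [Finset.sum_const, nsmul_eq_mul]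
    exact mul_le_mul_of_nonneg_right (hX.card_neighbours_le i hi) hc
  refine (Finset.abs_sum_le_sum_abs _ _).trans ?_
  refine (Finset.sum_le_sum hD).trans ?_
  rw [Finset.sum_const, nsmul_eq_mul, mul_assoc]
  exact mul_le_mul_of_nonneg_right hX.card_le (mul_nonneg hX.nonneg hc)

lemma expect_sq_le (hX : IsLocallyDependent S X supp N D) :
    expectUnif n (fun y => (∑ i ∈ S, X i y) ^ 2) ≤ N * D := by
  rw [hX.expect_sq_eq]
  have := hX.abs_sum_sum_le (fun i j => expectUnif n (fun y => X i y * X j y)) zero_le_one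
    fun i hi j hj => hX.abs_expect_mul_le_one hi hj
  linarith [le_abs_self (∑ i ∈ S, ∑ j ∈ neighbours S supp i,
    expectUnif n (fun y => X i y * X j y))]

lemma abs_expect_mul_pow_sub_le (hX : IsLocallyDependent S X supp N D) (q : ℕ) {i : ι}
    (hi : i ∈ S) :
    |expectUnif n (fun y => X i y * (∑ k ∈ S, X k y) ^ (q + 2)) -
        (q + 2) * ∑ j ∈ neighbours S supp i,
          expectUnif n (fun y => X i y * X j y * (∑ k ∈ S, X k y) ^ (q + 1))| ≤
      (q + 2) ^ 2 * D ^ 2 * expectUnif n (fun y => (|∑ k ∈ S, X k y| + 2 * D) ^ q) := by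
  have h0 : expectUnif n (fun y => X i y *
      (∑ k ∈ S, X k y - ∑ k ∈ neighbours S supp i, X k y) ^ (q + 2)) = 0 := by
    rw [hX.expect_mul_pow_eq (neighbours_subset S supp i)
      (fun j hj hn => disjoint_of_notMem_neighbours hj hn) (hX.dependsOn i hi),
      hX.expect_eq_zero i hi, zero_mul]
  have h1 : expectUnif n (fun y => X i y * (∑ k ∈ S, X k y) ^ (q + 2)) -
        (q + 2) * ∑ j ∈ neighbours S supp i,
          expectUnif n (fun y => X i y * X j y * (∑ k ∈ S, X k y) ^ (q + 1)) =
      expectUnif n (fun y => X i y * ((∑ k ∈ S, X k y) ^ (q + 2) -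
        (∑ k ∈ S, X k y - ∑ k ∈ neighbours S supp i, X k y) ^ (q + 2) -
        (q + 2) * (∑ k ∈ neighbours S supp i, X k y) * (∑ k ∈ S, X k y) ^ (q + 1))) := by
    rw [← expectUnif_sum, ← expectUnif_const_mul, ← sub_zero (expectUnif n _), ← h0,
      ← expectUnif_sub, ← expectUnif_sub]
    congr 1
    ext y
    rw [← Finset.sum_mul, ← Finset.mul_sum]
    ring
  rw [h1, ← expectUnif_const_mul]
  refine abs_expectUnif_le n fun y => ?_
  have hh : |∑ k ∈ neighbours S supp i, X k y| ≤ D :=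
    (hX.abs_sum_le (neighbours_subset S supp i) y).trans (hX.card_neighbours_le i hi)
  have hD := hX.nonneg
  rw [abs_mul]
  refine (mul_le_of_le_one_left (abs_nonneg _) (hX.abs_le_one i hi y)).trans ?_
  refine (abs_sub_pow_sub_taylor_le q _ _).trans ?_
  rw [← sq_abs (∑ k ∈ neighbours S supp i, X k y)]
  gcongr
  linarith

lemma abs_expect_mul_mul_pow_sub_le (hX : IsLocallyDependent S X supp N D) (q : ℕ) {i j : ι}
    (hi : i ∈ S) (hj : j ∈ S) :
    |expectUnif n (fun y => X i y * X j y * (∑ k ∈ S, X k y) ^ (q + 1)) -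
        expectUnif n (fun y => X i y * X j y) *
          expectUnif n (fun y => (∑ k ∈ S, X k y) ^ (q + 1))| ≤
      4 * (q + 1) * D * expectUnif n (fun y => (|∑ k ∈ S, X k y| + 2 * D) ^ q) := by
  classical
  set A := neighbours S supp i ∪ neighbours S supp j with hA
  have hAS : A ⊆ S := Finset.union_subset (neighbours_subset _ _ _) (neighbours_subset _ _ _)
  have hD := hX.nonneg
  have hcard : (A.card : ℝ) ≤ 2 * D := by
    have h1 : (A.card : ℝ) ≤ (neighbours S supp i).card + (neighbours S supp j).card := by
      exact_mod_cast Finset.card_union_le _ _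
    linarith [hX.card_neighbours_le i hi, hX.card_neighbours_le j hj]
  have hdep : DependsOn (fun y => X i y * X j y) (supp i ∪ supp j) := by
    intro y z hyz
    simp only
    rw [hX.dependsOn i hi fun k hk => hyz k (Or.inl hk),
      hX.dependsOn j hj fun k hk => hyz k (Or.inr hk)]
  have hU := hX.expect_mul_pow_eq hAS (B := supp i ∪ supp j) (fun k hk hn => by
    rw [hA, Finset.mem_union, not_or] at hn
    exact Set.disjoint_union_left.2 ⟨disjoint_of_notMem_neighbours hk hn.1,
      disjoint_of_notMem_neighbours hk hn.2⟩) hdep (q + 1)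
  have hdiff : ∀ y, |(∑ k ∈ S, X k y) ^ (q + 1) -
      (∑ k ∈ S, X k y - ∑ k ∈ A, X k y) ^ (q + 1)| ≤
      (q + 1) * (2 * D) * (|∑ k ∈ S, X k y| + 2 * D) ^ q := fun y => by
    have hh := (hX.abs_sum_le hAS y).trans hcard
    refine (abs_pow_sub_sub_pow_le q _ _).trans ?_
    gcongr
  have e1 : |expectUnif n (fun y => X i y * X j y * ((∑ k ∈ S, X k y) ^ (q + 1) -
      (∑ k ∈ S, X k y - ∑ k ∈ A, X k y) ^ (q + 1)))| ≤
      (q + 1) * (2 * D) * expectUnif n (fun y => (|∑ k ∈ S, X k y| + 2 * D) ^ q) := by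
    rw [← expectUnif_const_mul]
    refine abs_expectUnif_le n fun y => ?_
    rw [abs_mul]
    exact (mul_le_of_le_one_left (abs_nonneg _) (hX.abs_mul_le_one hi hj y)).trans (hdiff y)
  have e2 : |expectUnif n (fun y => (∑ k ∈ S, X k y) ^ (q + 1) -
      (∑ k ∈ S, X k y - ∑ k ∈ A, X k y) ^ (q + 1))| ≤
      (q + 1) * (2 * D) * expectUnif n (fun y => (|∑ k ∈ S, X k y| + 2 * D) ^ q) := by
    rw [← expectUnif_const_mul]
    exact abs_expectUnif_le n hdiff
  have e3 := (abs_mul (expectUnif n (fun y => X i y * X j y)) _).le.trans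
    ((mul_le_of_le_one_left (abs_nonneg _) (hX.abs_expect_mul_le_one hi hj)).trans e2)
  simp only [mul_sub (X _ _ * X _ _)] at e1
  rw [expectUnif_sub, hU] at e1
  rw [expectUnif_sub] at e3
  have e4 := (abs_sub _ _).trans (add_le_add e1 e3)
  refine le_trans (le_of_eq ?_) (e4.trans (le_of_eq ?_))
  · congr 1
    ring
  · ring

/-- Approximate Stein recursion for the moments of a sum of locally dependent variables. -/
lemma abs_moment_sub_le (hX : IsLocallyDependent S X supp N D) (q : ℕ) :
    |expectUnif n (fun y => (∑ k ∈ S, X k y) ^ (q + 3)) -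
        (q + 2) * expectUnif n (fun y => (∑ k ∈ S, X k y) ^ 2) *
          expectUnif n (fun y => (∑ k ∈ S, X k y) ^ (q + 1))| ≤
      5 * (q + 2) ^ 2 * (N * D ^ 2) *
        expectUnif n (fun y => (|∑ k ∈ S, X k y| + 2 * D) ^ q) := by
  set A := expectUnif n (fun y => (|∑ k ∈ S, X k y| + 2 * D) ^ q) with hA
  have hD := hX.nonneg
  have hN : 0 ≤ N := (Nat.cast_nonneg _).trans hX.card_le
  have hA0 : 0 ≤ A := by
    have := expectUnif_mono n (f := fun _ => 0)
      (g := fun y => (|∑ k ∈ S, X k y| + 2 * D) ^ q) (fun y => by positivity)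
    rwa [expectUnif_const] at this
  have h1 : |∑ i ∈ S, (expectUnif n (fun y => X i y * (∑ k ∈ S, X k y) ^ (q + 2)) -
        (q + 2) * ∑ j ∈ neighbours S supp i,
          expectUnif n (fun y => X i y * X j y * (∑ k ∈ S, X k y) ^ (q + 1)))| ≤
      N * ((q + 2) ^ 2 * D ^ 2 * A) := by
    refine (Finset.abs_sum_le_sum_abs _ _).trans ?_
    refine (Finset.sum_le_sum fun i hi => hX.abs_expect_mul_pow_sub_le q hi).trans ?_
    rw [Finset.sum_const, nsmul_eq_mul]
    exact mul_le_mul_of_nonneg_right hX.card_le (by positivity)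
  have h2 := hX.abs_sum_sum_le
    (fun i j => expectUnif n (fun y => X i y * X j y * (∑ k ∈ S, X k y) ^ (q + 1)) -
        expectUnif n (fun y => X i y * X j y) *
          expectUnif n (fun y => (∑ k ∈ S, X k y) ^ (q + 1)))
    (c := 4 * (q + 1) * D * A) (by positivity)
    (fun i hi j hj => hX.abs_expect_mul_mul_pow_sub_le q hi hj)
  have h3 : expectUnif n (fun y => (∑ k ∈ S, X k y) ^ (q + 3)) =
      ∑ i ∈ S, expectUnif n (fun y => X i y * (∑ k ∈ S, X k y) ^ (q + 2)) := by
    rw [← expectUnif_sum]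
    congr 1
    ext y
    rw [← Finset.sum_mul]
    ring
  simp only [Finset.sum_sub_distrib, ← Finset.sum_mul, ← Finset.mul_sum] at h1 h2
  rw [← h3] at h1
  rw [← hX.expect_sq_eq] at h2
  have h4 : |((q : ℝ) + 2)| = q + 2 := abs_of_nonneg (by positivity)
  have h5 := mul_le_mul_of_nonneg_left h2 (abs_nonneg ((q : ℝ) + 2))
  rw [← abs_mul, h4] at h5
  refine le_trans (le_of_eq ?_) ((abs_add_le _ _).trans ((add_le_add h1 h5).trans ?_))
  · congr 1
    ring
  · have h6 : 0 ≤ N * D ^ 2 * A := by positivity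
    have hq : (0 : ℝ) ≤ q := Nat.cast_nonneg q
    nlinarith [mul_nonneg h6 hq]

end IsLocallyDependent

end LocalDependence

section MomentLimit

lemma expectUnif_abs_add_pow_le {n q k : ℕ} (hqk : q ≤ 2 * k) {W : (Fin n → Bool) → ℝ}
    {C D s : ℝ} (hs : 0 < s) (hD : 0 ≤ D) (hDs : D ≤ s)
    (hW : expectUnif n (fun y => W y ^ (2 * k)) ≤ C * s ^ (2 * k)) :
    expectUnif n (fun y => (|W y| + 2 * D) ^ q) ≤
      2 ^ (2 * k) * (C + 2 ^ (2 * k)) * s ^ q := by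
  have hpt : ∀ y, (|W y| + 2 * D) ^ q ≤
      s ^ q * (2 ^ (2 * k) / s ^ (2 * k)) * (W y ^ (2 * k) + (2 * s) ^ (2 * k)) := fun y => by
    have h1 : (|W y| + 2 * D) ^ q ≤ (|W y| + 2 * s) ^ q := by gcongr
    have h2 : 1 ≤ (|W y| + 2 * s) / s := by
      rw [le_div_iff₀ hs]
      linarith [abs_nonneg (W y)]
    have h3 : ((|W y| + 2 * s) / s) ^ q ≤ ((|W y| + 2 * s) / s) ^ (2 * k) :=
      pow_le_pow_right₀ h2 hqk
    have h4 : (|W y| + 2 * s) ^ (2 * k) ≤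
        2 ^ (2 * k) * (W y ^ (2 * k) + (2 * s) ^ (2 * k)) := by
      refine (add_pow_le (abs_nonneg (W y)) (by positivity) (2 * k)).trans ?_
      rw [(even_two_mul k).pow_abs]
      have : 0 ≤ W y ^ (2 * k) := (even_two_mul k).pow_nonneg _
      gcongr
      · norm_num
      · omega
    calc (|W y| + 2 * D) ^ q ≤ s ^ q * ((|W y| + 2 * s) / s) ^ q := by
          rw [← mul_pow, mul_div_cancel₀ _ hs.ne']
          exact h1
      _ ≤ s ^ q * ((|W y| + 2 * s) / s) ^ (2 * k) := by gcongr
      _ ≤ s ^ q * ((2 ^ (2 * k) * (W y ^ (2 * k) + (2 * s) ^ (2 * k))) / s ^ (2 * k)) := by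
          rw [div_pow]
          gcongr
      _ = _ := by ring
  refine (expectUnif_mono n hpt).trans ?_
  rw [expectUnif_const_mul, expectUnif_add, expectUnif_const]
  calc _ ≤ s ^ q * (2 ^ (2 * k) / s ^ (2 * k)) * (C * s ^ (2 * k) + (2 * s) ^ (2 * k)) := by
        gcongr
    _ = _ := by
        rw [mul_pow]
        field_simp

/-- The even moments of a sum of locally dependent variables are bounded on the scale `s` with
`N * D ≤ s ^ 2`. -/
lemma exists_even_moment_le (k : ℕ) : ∃ C : ℝ, 0 ≤ C ∧ ∀ (n : ℕ) (ι : Type) (S : Finset ι)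
    (X : ι → (Fin n → Bool) → ℝ) (supp : ι → Set (Fin n)) (N D s : ℝ),
    IsLocallyDependent S X supp N D → 0 < s → N * D ≤ s ^ 2 → D ≤ s →
    expectUnif n (fun y => (∑ i ∈ S, X i y) ^ (2 * k)) ≤ C * s ^ (2 * k) := by
  induction k with
  | zero => exact ⟨1, zero_le_one, fun n ι S X supp N D s _ _ _ _ => by simp [expectUnif_const]⟩
  | succ k ih =>
    obtain _ | k := k
    · exact ⟨1, zero_le_one, fun n ι S X supp N D s hX _ hND _ => by
        simpa using hX.expect_sq_le.trans hND⟩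
    obtain ⟨C, hC0, hC⟩ := ih
    set K : ℝ := 2 ^ (2 * (k + 1)) * (C + 2 ^ (2 * (k + 1))) with hK
    refine ⟨(2 * k + 3) * C + 5 * (2 * k + 3) ^ 2 * K, by positivity, ?_⟩
    intro n ι S X supp N D s hX hs hND hDs
    have hM := hC n ι S X supp N D s hX hs hND hDs
    have hD := hX.nonneg
    have hN : 0 ≤ N := (Nat.cast_nonneg _).trans hX.card_le
    have hA := expectUnif_abs_add_pow_le (q := 2 * k + 1) (by omega) hs hD hDs hM
    have hrec := (abs_le.1 (hX.abs_moment_sub_le (2 * k + 1))).2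
    have hV := hX.expect_sq_le.trans hND
    have hMnn : 0 ≤ expectUnif n (fun y => (∑ i ∈ S, X i y) ^ (2 * (k + 1))) := by
      have := expectUnif_mono n (f := fun _ => 0)
        (g := fun y => (∑ i ∈ S, X i y) ^ (2 * (k + 1)))
        (fun y => (even_two_mul _).pow_nonneg _)
      rwa [expectUnif_const] at this
    have hVM : expectUnif n (fun y => (∑ k ∈ S, X k y) ^ 2) *
        expectUnif n (fun y => (∑ i ∈ S, X i y) ^ (2 * (k + 1))) ≤
        s ^ 2 * (C * s ^ (2 * (k + 1))) := mul_le_mul hV hM hMnn (by positivity)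
    have hNDA : N * D ^ 2 * expectUnif n (fun y => (|∑ k ∈ S, X k y| + 2 * D) ^ (2 * k + 1)) ≤
        s ^ 2 * s * (K * s ^ (2 * k + 1)) := by
      have h1 : N * D ^ 2 ≤ s ^ 2 * s := by
        calc N * D ^ 2 = N * D * D := by ring
          _ ≤ s ^ 2 * s := by gcongr
      calc _ ≤ N * D ^ 2 * (K * s ^ (2 * k + 1)) := by gcongr
        _ ≤ _ := by gcongr
    have e1 : 2 * (k + 1 + 1) = 2 * k + 1 + 3 := by ring
    have e2 : 2 * k + 1 + 1 = 2 * (k + 1) := by ring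
    rw [e2] at hrec
    rw [e1]
    push_cast at hrec
    have hk : (0 : ℝ) ≤ k := Nat.cast_nonneg k
    calc _ ≤ (2 * k + 3) * (s ^ 2 * (C * s ^ (2 * (k + 1)))) +
          5 * (2 * k + 3) ^ 2 * (s ^ 2 * s * (K * s ^ (2 * k + 1))) := by
          have h1 := mul_le_mul_of_nonneg_left hVM (by positivity : (0 : ℝ) ≤ 2 * k + 3)
          have h2 := mul_le_mul_of_nonneg_left hNDA
            (by positivity : (0 : ℝ) ≤ 5 * (2 * k + 3) ^ 2)
          linarith
      _ = _ := by ring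

lemma gaussian_moment_rec (q : ℕ) :
    (if Even (q + 3) then ((q + 3 - 1).doubleFactorial : ℝ) else 0) =
      (q + 2) * (if Even (q + 1) then ((q + 1 - 1).doubleFactorial : ℝ) else 0) := by
  have h : Even (q + 3) ↔ Even (q + 1) := by
    rw [show q + 3 = q + 1 + 2 by ring, Nat.even_add]
    simp
  have e : q + 3 - 1 = q + 2 := by omega
  rw [e, Nat.doubleFactorial_add_two, Nat.add_sub_cancel]
  simp only [h]
  split_ifs <;> push_cast <;> ring

/-- Convergence of moments to those of the standard normal distribution for sums of locally
dependent variables of variance at least `c * s ^ 2`, if `N * D ≤ s ^ 2` and `D / s → 0`. -/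
theorem IsLocallyDependent.tendsto_moment {ι : ℕ → Type} {S : ∀ n, Finset (ι n)}
    {X : ∀ n, ι n → (Fin n → Bool) → ℝ} {supp : ∀ n, ι n → Set (Fin n)} {N D s : ℕ → ℝ} {c : ℝ}
    (hc : 0 < c) (hX : ∀ n, IsLocallyDependent (S n) (X n) (supp n) (N n) (D n))
    (hs : ∀ᶠ n in atTop, 0 < s n) (hND : ∀ n, N n * D n ≤ s n ^ 2)
    (hV : ∀ᶠ n in atTop, c * s n ^ 2 ≤ expectUnif n (fun y => (∑ i ∈ S n, X n i y) ^ 2))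
    (hDs : Tendsto (fun n => D n / s n) atTop (nhds 0)) (r : ℕ) :
    Tendsto (fun n => expectUnif n (fun y => (∑ i ∈ S n, X n i y) ^ r) /
        √(expectUnif n (fun y => (∑ i ∈ S n, X n i y) ^ 2)) ^ r) atTop
      (nhds (if Even r then ((r - 1).doubleFactorial : ℝ) else 0)) := by
  have hVpos : ∀ᶠ n in atTop, 0 < expectUnif n (fun y => (∑ i ∈ S n, X n i y) ^ 2) := by
    filter_upwards [hs, hV] with n hn hVn
    exact lt_of_lt_of_le (by positivity) hVn
  induction r using Nat.strong_induction_on with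
  | _ r ih =>
  match r, ih with
  | 0, _ => simp [expectUnif_const]
  | 1, _ =>
    have h0 : ∀ n, expectUnif n (fun y => (∑ i ∈ S n, X n i y) ^ 1) = 0 := fun n => by
      simp only [pow_one]
      rw [expectUnif_sum]
      exact Finset.sum_eq_zero fun i hi => (hX n).expect_eq_zero i hi
    simp only [h0]
    simp
  | 2, _ =>
    have h2 : (if Even 2 then ((2 - 1).doubleFactorial : ℝ) else 0) = 1 := by
      simp
    rw [h2]
    refine tendsto_const_nhds.congr' ?_
    filter_upwards [hVpos] with n hn
    rw [Real.sq_sqrt hn.le, div_self hn.ne']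
  | q + 3, ih =>
    rw [gaussian_moment_rec]
    have h1 := (ih (q + 1) (by omega)).const_mul ((q : ℝ) + 2)
    obtain ⟨C, hC0, hC⟩ := exists_even_moment_le q
    set K : ℝ := 2 ^ (2 * q) * (C + 2 ^ (2 * q)) with hK
    have hlim := hDs.const_mul (5 * ((q : ℝ) + 2) ^ 2 * K / √c ^ (q + 3))
    rw [mul_zero] at hlim
    have hDs1 : ∀ᶠ n in atTop, D n / s n < 1 := hDs.eventually_lt_const one_pos
    have hdiff : Tendsto (fun n => expectUnif n (fun y => (∑ i ∈ S n, X n i y) ^ (q + 3)) /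
        √(expectUnif n (fun y => (∑ i ∈ S n, X n i y) ^ 2)) ^ (q + 3) -
        ((q : ℝ) + 2) * (expectUnif n (fun y => (∑ i ∈ S n, X n i y) ^ (q + 1)) /
        √(expectUnif n (fun y => (∑ i ∈ S n, X n i y) ^ 2)) ^ (q + 1))) atTop (nhds 0) := by
      refine squeeze_zero_norm' ?_ hlim
      filter_upwards [hs, hV, hVpos, hDs1] with n hsn hVn hVpn hDn
      rw [div_lt_one hsn] at hDn
      have hDnn := (hX n).nonneg
      have hA := expectUnif_abs_add_pow_le (q := q) (by omega) hsn hDnn hDn.le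
        (hC n _ _ _ _ _ _ _ (hX n) hsn (hND n) hDn.le)
      have hrec := (hX n).abs_moment_sub_le q
      set V := expectUnif n (fun y => (∑ i ∈ S n, X n i y) ^ 2) with hVdef
      have hroot : √c * s n ≤ √V := by
        refine Real.le_sqrt_of_sq_le ?_
        rw [mul_pow, Real.sq_sqrt hc.le]
        exact hVn
      have hsc : 0 < √c := Real.sqrt_pos.2 hc
      have hsV : 0 < √V := Real.sqrt_pos.2 hVpn
      have e : ∀ a b : ℝ, a / √V ^ (q + 3) - (q + 2) * (b / √V ^ (q + 1)) =
          (a - (q + 2) * V * b) / √V ^ (q + 3) := fun a b => by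
        have : V = √V ^ 2 := (Real.sq_sqrt hVpn.le).symm
        rw [sub_div]
        congr 1
        conv_rhs => rw [this, Real.sqrt_sq hsV.le]
        field_simp
        ring
      rw [e, Real.norm_eq_abs, abs_div, abs_of_pos (by positivity : 0 < √V ^ (q + 3))]
      have hNn : 0 ≤ N n := (Nat.cast_nonneg _).trans (hX n).card_le
      calc _ ≤ (5 * ((q : ℝ) + 2) ^ 2 * (N n * D n ^ 2) * (K * s n ^ q)) /
            (√c * s n) ^ (q + 3) := by
            gcongr
            exact hrec.trans (by gcongr)
        _ = (5 * ((q : ℝ) + 2) ^ 2 * (N n * D n) * D n * (K * s n ^ q)) /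
            (√c * s n) ^ (q + 3) := by ring
        _ ≤ (5 * ((q : ℝ) + 2) ^ 2 * (s n ^ 2) * D n * (K * s n ^ q)) /
            (√c * s n) ^ (q + 3) := by
            gcongr
            exact hND n
        _ = _ := by
            rw [mul_pow]
            field_simp
            ring
    have := hdiff.add h1
    rw [zero_add] at this
    refine this.congr fun n => ?_
    ring

end MomentLimit

section Occurrences

/-- The strictly increasing maps `Fin m → Fin n`. -/
noncomputable def embeddings (m n : ℕ) : Finset (Fin m → Fin n) :=
  open Classical in {π | StrictMono π}

lemma mem_embeddings {m n : ℕ} {π : Fin m → Fin n} : π ∈ embeddings m n ↔ StrictMono π := by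
  simp [embeddings]

/-- The indicator of the event that `x` occurs in `y` at the positions `π`. -/
def occurs {m n : ℕ} (x : Fin m → Bool) (π : Fin m → Fin n) (y : Fin n → Bool) : ℝ :=
  if ∀ j, y (π j) = x j then 1 else 0

lemma omega_eq_sum {m n : ℕ} (x : Fin m → Bool) (y : Fin n → Bool) :
    (omega x y : ℝ) = ∑ π ∈ embeddings m n, occurs x π y := by
  classical
  simp only [omega, occurs, Finset.sum_boole]
  rw [Nat.card_eq_fintype_card, Fintype.card_subtype]
  congr 2
  ext π
  simp [mem_embeddings]

lemma dependsOn_occurs {m n : ℕ} (x : Fin m → Bool) (π : Fin m → Fin n) :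
    DependsOn (occurs x π) (Set.range π) := by
  intro y z h
  have : ∀ j, y (π j) = z (π j) := fun j => h _ (Set.mem_range_self j)
  simp only [occurs, this]

lemma expectUnif_coord {n : ℕ} (g : Bool → ℝ) (i : Fin n) :
    expectUnif n (fun y => g (y i)) = (g true + g false) / 2 := by
  have h1 : ∑ y : Fin n → Bool, g (y i) = ∑ y : Fin n → Bool, g (!(y i)) :=
    Finset.sum_bij' (fun y _ => Function.update y i (!(y i)))
      (fun y _ => Function.update y i (!(y i))) (by simp) (by simp) (by simp) (by simp) (by simp)
  have h2 : ∀ y : Fin n → Bool, g (y i) + g (!(y i)) = g true + g false := fun y => by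
    cases y i <;> simp [add_comm]
  have h3 : ∑ y : Fin n → Bool, g (y i) + ∑ y : Fin n → Bool, g (!(y i)) =
      2 ^ n * (g true + g false) := by
    rw [← Finset.sum_add_distrib, Finset.sum_congr rfl fun y _ => h2 y]
    simp [mul_add]
  rw [← h1] at h3
  rw [expectUnif, div_eq_iff (by positivity)]
  linarith

lemma expectUnif_prod_coord {m n : ℕ} (g : Fin m → Bool → ℝ) {π : Fin m → Fin n}
    (hπ : Function.Injective π) (A : Finset (Fin m)) :
    expectUnif n (fun y => ∏ j ∈ A, g j (y (π j))) = ∏ j ∈ A, (g j true + g j false) / 2 := by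
  classical
  induction A using Finset.induction_on with
  | empty => simp [expectUnif_const]
  | insert k A hk ih =>
    simp only [Finset.prod_insert hk]
    rw [expectUnif_mul_of_dependsOn (A := {π k}), expectUnif_coord, ih]
    · intro y z h
      simp only [h (π k) rfl]
    · intro y z h
      refine Finset.prod_congr rfl fun j hj => ?_
      rw [h (π j)]
      intro hjk
      exact hk (hπ hjk ▸ hj)

lemma expect_occurs {m n : ℕ} (x : Fin m → Bool) {π : Fin m → Fin n}
    (hπ : Function.Injective π) : expectUnif n (occurs x π) = (1 / 2) ^ m := by
  have h : occurs x π = fun y => ∏ j, if y (π j) = x j then (1 : ℝ) else 0 := by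
    ext y
    simp [occurs, Finset.prod_boole]
  rw [h, expectUnif_prod_coord (fun j b => if b = x j then (1 : ℝ) else 0) hπ]
  have : ∀ j, ((if true = x j then (1 : ℝ) else 0) + if false = x j then 1 else 0) / 2 = 1 / 2 :=
    fun j => by cases x j <;> simp
  rw [Finset.prod_congr rfl fun j _ => this j]
  simp

/-- The sign `1` for `true` and `-1` for `false`. -/
def boolSign (b : Bool) : ℝ := if b then 1 else -1

lemma boolSign_mul_self (b : Bool) : boolSign b * boolSign b = 1 := by
  cases b <;> simp [boolSign]

lemma abs_boolSign (b : Bool) : |boolSign b| = 1 := by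
  cases b <;> simp [boolSign]

lemma expect_boolSign {n : ℕ} (i : Fin n) : expectUnif n (fun y => boolSign (y i)) = 0 := by
  rw [expectUnif_coord]
  simp [boolSign]

lemma expect_boolSign_mul {n : ℕ} (i k : Fin n) :
    expectUnif n (fun y => boolSign (y i) * boolSign (y k)) = if i = k then 1 else 0 := by
  split_ifs with h
  · subst h
    simp [boolSign_mul_self, expectUnif_const]
  · rw [expectUnif_mul_of_dependsOn (A := {i}), expect_boolSign, zero_mul]
    · intro y z hyz
      simp only [hyz i rfl]
    · intro y z hyz
      simp only [hyz k (fun hk => h hk.symm)]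

lemma expect_sum_boolSign_sq {n : ℕ} (A : Finset (Fin n)) :
    expectUnif n (fun y => (∑ i ∈ A, boolSign (y i)) ^ 2) = A.card := by
  simp only [sq, Finset.sum_mul_sum]
  rw [expectUnif_sum]
  have : ∀ i ∈ A, expectUnif n (fun y => ∑ k ∈ A, boolSign (y i) * boolSign (y k)) = 1 :=
    fun i hi => by
      rw [expectUnif_sum]
      simp [expect_boolSign_mul, hi]
  rw [Finset.sum_congr rfl this]
  simp

lemma expect_occurs_mul_boolSign {m n : ℕ} (x : Fin m → Bool) {π : Fin m → Fin n}
    (hπ : Function.Injective π) (i : Fin n) :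
    expectUnif n (fun y => occurs x π y * boolSign (y i)) =
      (1 / 2) ^ m * ∑ j, if π j = i then boolSign (x j) else 0 := by
  by_cases hi : i ∈ Set.range π
  · obtain ⟨k, rfl⟩ := hi
    have h1 : (fun y => occurs x π y * boolSign (y (π k))) =
        fun y => occurs x π y * boolSign (x k) := by
      ext y
      unfold occurs
      split_ifs with h
      · rw [h k]
      · simp
    rw [h1, expectUnif_mul_const, expect_occurs x hπ]
    simp [hπ.eq_iff]
  · rw [expectUnif_mul_of_dependsOn (dependsOn_occurs x π), expect_boolSign, mul_zero]
    · symm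
      rw [Finset.sum_eq_zero, mul_zero]
      intro j _
      rw [if_neg fun h => hi ⟨j, h⟩]
    · intro y z h
      simp only [h i hi]

/-- The first `K` positions. -/
def initialPositions (n K : ℕ) : Finset (Fin n) := {i | i.val < K}

lemma mem_initialPositions {n K : ℕ} {i : Fin n} : i ∈ initialPositions n K ↔ i.val < K := by
  simp [initialPositions]

lemma expect_occurs_mul_sum_boolSign {m n : ℕ} (x : Fin m → Bool) {π : Fin m → Fin n}
    (hπ : Function.Injective π) (A : Finset (Fin n)) :
    expectUnif n (fun y => occurs x π y * ∑ i ∈ A, boolSign (y i)) =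
      (1 / 2) ^ m * ∑ j, if π j ∈ A then boolSign (x j) else 0 := by
  simp only [Finset.mul_sum]
  rw [expectUnif_sum]
  simp only [expect_occurs_mul_boolSign x hπ, ← Finset.mul_sum]
  rw [Finset.sum_comm]
  simp

lemma card_interval {n a l : ℕ} (h : a + l ≤ n) :
    ({i : Fin n | a ≤ i.val ∧ i.val < a + l} : Finset (Fin n)).card = l := by
  have : (({i : Fin n | a ≤ i.val ∧ i.val < a + l} : Finset (Fin n)).map Fin.valEmbedding) =
      Finset.Ico a (a + l) := by
    ext k
    simp only [Finset.mem_map, Finset.mem_filter, Finset.mem_univ, true_and,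
      Fin.valEmbedding_apply, Finset.mem_Ico]
    constructor
    · rintro ⟨i, hi, rfl⟩
      exact hi
    · intro hk
      exact ⟨⟨k, by omega⟩, hk, rfl⟩
  rw [← Finset.card_map Fin.valEmbedding, this]
  simp

lemma card_initialPositions {n K : ℕ} (h : K ≤ n) : (initialPositions n K).card = K := by
  have := card_interval (n := n) (a := 0) (l := K) (by omega)
  simpa [initialPositions] using this

/-- Embeddings whose first position, and no other, is among the first `K`. -/
noncomputable def singleInitial (p n K : ℕ) : Finset (Fin (p + 1) → Fin n) :=
  {π ∈ embeddings (p + 1) n | π 0 ∈ initialPositions n K ∧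
    ∀ j : Fin p, π j.succ ∉ initialPositions n K}

/-- Embeddings with at least two positions among the first `K`. -/
noncomputable def multipleInitial (p n K : ℕ) : Finset (Fin (p + 1) → Fin n) :=
  {π ∈ embeddings (p + 1) n | ∃ j : Fin p, π j.succ ∈ initialPositions n K}

lemma le_card_singleInitial {p n K b : ℕ} (hKb : K ≤ b) (hb : (p + 1) * b ≤ n) :
    K * b ^ p ≤ (singleInitial p n K).card := by
  classical
  let B : Fin (p + 1) → Finset (Fin n) := fun j =>
    {i : Fin n | j.val * b ≤ i.val ∧ i.val < j.val * b + if j = 0 then K else b}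
  have hjb : ∀ j : Fin (p + 1), j.val * b + b ≤ n := fun j => by
    have : (j.val + 1) * b ≤ (p + 1) * b := Nat.mul_le_mul_right _ (by omega)
    linarith
  have hcard : (Fintype.piFinset B).card = K * b ^ p := by
    rw [Fintype.card_piFinset, Fin.prod_univ_succ]
    have h0 : (B 0).card = K := by
      refine card_interval ?_
      have := hjb 0
      simp only [if_true]
      omega
    have h1 : ∀ j : Fin p, (B j.succ).card = b := fun j => by
      have hj := hjb j.succ
      have := card_interval hj
      simpa [B, Fin.succ_ne_zero] using this
    rw [h0, Finset.prod_congr rfl fun j _ => h1 j]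
    simp
  rw [← hcard]
  refine Finset.card_le_card fun π hπ => ?_
  rw [Fintype.mem_piFinset] at hπ
  have hlow : ∀ j, j.val * b ≤ (π j).val := fun j => (Finset.mem_filter.1 (hπ j)).2.1
  have hup : ∀ j, (π j).val < j.val * b + b := fun j => by
    have h := (Finset.mem_filter.1 (hπ j)).2.2
    split_ifs at h <;> omega
  have h0 : (π 0).val < K := by
    have h := (Finset.mem_filter.1 (hπ 0)).2.2
    simpa using h
  simp only [singleInitial, Finset.mem_filter, mem_embeddings, mem_initialPositions]
  refine ⟨fun i j hij => ?_, h0, fun j => ?_⟩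
  · have h1 : (i.val + 1) * b ≤ j.val * b := Nat.mul_le_mul_right _ hij
    have h2 := hlow j
    have h3 := hup i
    rw [Fin.lt_def]
    linarith
  · have h1 := hlow j.succ
    have h2 : 1 * b ≤ (j.succ : Fin (p + 1)).val * b := Nat.mul_le_mul_right _ (by simp)
    omega

lemma card_multipleInitial_mul_le {p n K : ℕ} (hK : K ≤ n) :
    (multipleInitial p n K).card * n ≤ p * (K ^ 2 * n ^ p) := by
  classical
  have hsub : multipleInitial p n K ⊆ Finset.univ.biUnion fun j : Fin p =>
      ({π | π 0 ∈ initialPositions n K ∧ π j.succ ∈ initialPositions n K} :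
        Finset (Fin (p + 1) → Fin n)) := by
    intro π hπ
    simp only [multipleInitial, Finset.mem_filter, mem_embeddings] at hπ
    obtain ⟨hm, j, hj⟩ := hπ
    simp only [Finset.mem_biUnion, Finset.mem_univ, true_and, Finset.mem_filter]
    refine ⟨j, ?_, hj⟩
    rw [mem_initialPositions] at hj ⊢
    have := hm (Fin.succ_pos j)
    rw [Fin.lt_def] at this
    omega
  have hj : ∀ j : Fin p, (({π | π 0 ∈ initialPositions n K ∧ π j.succ ∈ initialPositions n K} :
      Finset (Fin (p + 1) → Fin n)).card) * n ≤ K ^ 2 * n ^ p := by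
    obtain _ | p := p
    · exact fun j => j.elim0
    intro j
    have hc : ({π | π 0 ∈ initialPositions n K ∧ π j.succ ∈ initialPositions n K} :
        Finset (Fin (p + 1 + 1) → Fin n)).card ≤
        (initialPositions n K ×ˢ initialPositions n K ×ˢ
          (Finset.univ : Finset (Fin p → Fin n))).card := by
      refine Finset.card_le_card_of_injOn
        (fun π => (π 0, π j.succ, fun k => π (j.succAbove k).succ)) ?_ ?_
      · intro π hπ
        simpa using hπ
      · intro π _ ρ _ h
        simp only [Prod.mk.injEq] at h
        ext i : 1
        induction i using Fin.cases with
        | zero => exact h.1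
        | succ i =>
          by_cases hij : i = j
          · rw [hij]
            exact h.2.1
          · obtain ⟨k, rfl⟩ := Fin.exists_succAbove_eq hij
            exact congrFun h.2.2 k
    rw [Finset.card_product, Finset.card_product, card_initialPositions hK] at hc
    simp only [Finset.card_univ, Fintype.card_pi, Fintype.card_fin, Finset.prod_const] at hc
    calc _ ≤ K * (K * n ^ p) * n := Nat.mul_le_mul_right _ hc
      _ = _ := by ring
  calc _ ≤ (∑ j : Fin p, ({π | π 0 ∈ initialPositions n K ∧ π j.succ ∈ initialPositions n K} :
        Finset (Fin (p + 1) → Fin n)).card) * n :=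
        Nat.mul_le_mul_right _ ((Finset.card_le_card hsub).trans Finset.card_biUnion_le)
    _ ≤ ∑ j : Fin p, K ^ 2 * n ^ p := by
        rw [Finset.sum_mul]
        exact Finset.sum_le_sum fun j _ => hj j
    _ = _ := by simp

lemma card_embeddings_le (m n : ℕ) : (embeddings m n).card ≤ n ^ m := by
  refine (Finset.card_le_univ _).trans ?_
  simp

lemma card_neighbours_range_le (p n : ℕ) (π : Fin (p + 1) → Fin n) :
    (neighbours (embeddings (p + 1) n) (fun ρ => Set.range ρ) π).card ≤ (p + 1) ^ 2 * n ^ p := by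
  classical
  have hsub : neighbours (embeddings (p + 1) n) (fun ρ => Set.range ρ) π ⊆
      Finset.univ.biUnion fun jk : Fin (p + 1) × Fin (p + 1) =>
        ({ρ | ρ jk.2 = π jk.1} : Finset (Fin (p + 1) → Fin n)) := by
    intro ρ hρ
    have h := (Finset.mem_filter.1 hρ).2
    rw [Set.not_disjoint_iff] at h
    obtain ⟨_, ⟨j, rfl⟩, k, hk⟩ := h
    simp only [Finset.mem_biUnion, Finset.mem_univ, true_and, Finset.mem_filter]
    exact ⟨(j, k), hk⟩
  have hjk : ∀ jk : Fin (p + 1) × Fin (p + 1),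
      ({ρ | ρ jk.2 = π jk.1} : Finset (Fin (p + 1) → Fin n)).card ≤ n ^ p := fun jk => by
    have hc : ({ρ | ρ jk.2 = π jk.1} : Finset (Fin (p + 1) → Fin n)).card ≤
        (Finset.univ : Finset (Fin p → Fin n)).card := by
      refine Finset.card_le_card_of_injOn (fun ρ k => ρ (jk.2.succAbove k)) (by simp) ?_
      intro ρ hρ σ hσ h
      simp only [Finset.coe_filter, Finset.mem_univ, true_and, Set.mem_ofPred_eq] at hρ hσ
      ext i : 1
      by_cases hi : i = jk.2
      · rw [hi, hρ, hσ]
      · obtain ⟨k, rfl⟩ := Fin.exists_succAbove_eq hi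
        exact congrFun h k
    simpa using hc
  calc _ ≤ ∑ jk : Fin (p + 1) × Fin (p + 1),
        ({ρ | ρ jk.2 = π jk.1} : Finset (Fin (p + 1) → Fin n)).card :=
        (Finset.card_le_card hsub).trans Finset.card_biUnion_le
    _ ≤ ∑ jk : Fin (p + 1) × Fin (p + 1), n ^ p := Finset.sum_le_sum fun jk _ => hjk jk
    _ = _ := by simp [sq]

/-- The centred indicator of the event that `x` occurs in `y` at the positions `π`. -/
noncomputable def centredOccurs {m n : ℕ} (x : Fin m → Bool) (π : Fin m → Fin n)
    (y : Fin n → Bool) : ℝ :=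
  occurs x π y - expectUnif n (occurs x π)

lemma isLocallyDependent_centredOccurs (p n : ℕ) (x : Fin (p + 1) → Bool) :
    IsLocallyDependent (embeddings (p + 1) n) (centredOccurs x) (fun π => Set.range π)
      ((n : ℝ) ^ (p + 1)) ((p + 1) ^ 2 * (n : ℝ) ^ p) where
  dependsOn π _ := fun y z h => by
    simp only [centredOccurs, dependsOn_occurs x π h]
  expect_eq_zero π _ := by
    unfold centredOccurs
    rw [expectUnif_sub, expectUnif_const, sub_self]
  abs_le_one π hπ y := by
    unfold centredOccurs
    rw [expect_occurs x (mem_embeddings.1 hπ).injective]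
    have h0 : (0 : ℝ) ≤ (1 / 2) ^ (p + 1) := by positivity
    have h1 : ((1 : ℝ) / 2) ^ (p + 1) ≤ 1 := pow_le_one₀ (by norm_num) (by norm_num)
    unfold occurs
    rw [abs_le]
    split_ifs <;> constructor <;> linarith
  nonneg := by positivity
  card_le := by exact_mod_cast card_embeddings_le (p + 1) n
  card_neighbours_le π _ := by exact_mod_cast card_neighbours_range_le p n π

lemma omega_sub_expect_eq_sum {m n : ℕ} (x : Fin m → Bool) (y : Fin n → Bool) :
    (omega x y : ℝ) - expectUnif n (fun z => (omega x z : ℝ)) =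
      ∑ π ∈ embeddings m n, centredOccurs x π y := by
  simp only [omega_eq_sum, centredOccurs]
  rw [expectUnif_sum, Finset.sum_sub_distrib]

lemma sub_le_sum_boolSign {p n K : ℕ} (x : Fin (p + 1) → Bool) {π : Fin (p + 1) → Fin n}
    (hπ : π ∈ embeddings (p + 1) n) :
    (if π ∈ singleInitial p n K then (1 : ℝ) else 0) -
        (p + 1) * (if π ∈ multipleInitial p n K then 1 else 0) ≤
      boolSign (x 0) * ∑ j, if π j ∈ initialPositions n K then boolSign (x j) else 0 := by
  by_cases hm : ∃ j : Fin p, π j.succ ∈ initialPositions n K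
  · have h1 : π ∉ singleInitial p n K := fun h => by
      obtain ⟨j, hj⟩ := hm
      exact (Finset.mem_filter.1 h).2.2 j hj
    have h2 : π ∈ multipleInitial p n K := Finset.mem_filter.2 ⟨hπ, hm⟩
    rw [if_neg h1, if_pos h2]
    have h3 : |boolSign (x 0) * ∑ j, if π j ∈ initialPositions n K then boolSign (x j) else 0| ≤
        p + 1 := by
      rw [abs_mul, abs_boolSign, one_mul]
      refine (Finset.abs_sum_le_sum_abs _ _).trans ?_
      have h4 : ∀ j ∈ (Finset.univ : Finset (Fin (p + 1))),
          |if π j ∈ initialPositions n K then boolSign (x j) else 0| ≤ 1 := fun j _ => by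
        split_ifs
        · exact (abs_boolSign _).le
        · simp
      refine (Finset.sum_le_sum h4).trans ?_
      simp
    linarith [(abs_le.1 h3).1]
  · have h2 : π ∉ multipleInitial p n K := fun h => hm (Finset.mem_filter.1 h).2
    rw [if_neg h2, Fin.sum_univ_succ]
    push Not at hm
    have h3 : (π ∈ singleInitial p n K) ↔ π 0 ∈ initialPositions n K := by
      simp [singleInitial, hπ, hm]
    simp only [hm, h3, if_false, Finset.sum_const_zero]
    split_ifs <;> simp [boolSign_mul_self]

lemma variance_lower_bound {p n K : ℕ} (x : Fin (p + 1) → Bool) (hK : K ≤ n)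
    (h : (0 : ℝ) ≤ (singleInitial p n K).card - (p + 1) * (multipleInitial p n K).card) :
    ((1 / 2) ^ (p + 1) *
        ((singleInitial p n K).card - (p + 1) * (multipleInitial p n K).card)) ^ 2 ≤
      expectUnif n (fun y => (∑ π ∈ embeddings (p + 1) n, centredOccurs x π y) ^ 2) * K := by
  set T : (Fin n → Bool) → ℝ := fun y => ∑ i ∈ initialPositions n K, boolSign (y i) with hT
  have hT0 : expectUnif n T = 0 := by
    rw [hT, expectUnif_sum]
    exact Finset.sum_eq_zero fun i _ => expect_boolSign i
  have hcov : expectUnif n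
      (fun y => (∑ π ∈ embeddings (p + 1) n, centredOccurs x π y) * T y) =
      (1 / 2) ^ (p + 1) * ∑ π ∈ embeddings (p + 1) n,
        ∑ j, if π j ∈ initialPositions n K then boolSign (x j) else 0 := by
    simp only [Finset.sum_mul, Finset.mul_sum (embeddings (p + 1) n)]
    rw [expectUnif_sum]
    refine Finset.sum_congr rfl fun π hπ => ?_
    simp only [centredOccurs, sub_mul]
    rw [expectUnif_sub, expectUnif_const_mul, hT0, mul_zero, sub_zero,
      expect_occurs_mul_sum_boolSign x (mem_embeddings.1 hπ).injective]
  have hlow : ((singleInitial p n K).card : ℝ) - (p + 1) * (multipleInitial p n K).card ≤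
      boolSign (x 0) * ∑ π ∈ embeddings (p + 1) n,
        ∑ j, if π j ∈ initialPositions n K then boolSign (x j) else 0 := by
    rw [Finset.mul_sum]
    refine le_trans (le_of_eq ?_) (Finset.sum_le_sum fun π hπ => sub_le_sum_boolSign x hπ)
    rw [Finset.sum_sub_distrib, ← Finset.mul_sum, Finset.sum_boole, Finset.sum_boole,
      Finset.filter_mem_eq_inter, Finset.filter_mem_eq_inter,
      Finset.inter_eq_right.2 (show singleInitial p n K ⊆ _ from Finset.filter_subset _ _),
      Finset.inter_eq_right.2 (show multipleInitial p n K ⊆ _ from Finset.filter_subset _ _)]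
  have hCS := expectUnif_mul_sq_le n
    (fun y => ∑ π ∈ embeddings (p + 1) n, centredOccurs x π y) T
  rw [hcov, hT, expect_sum_boolSign_sq, card_initialPositions hK] at hCS
  refine le_trans ?_ hCS
  rw [mul_pow, mul_pow]
  refine mul_le_mul_of_nonneg_left ?_ (by positivity)
  refine (pow_le_pow_left₀ h hlow 2).trans (le_of_eq ?_)
  rw [mul_pow, sq (boolSign _), boolSign_mul_self, one_mul]

lemma half_div_le_natCast_div {n a : ℕ} (ha : 0 < a) (hn : a ≤ n) :
    (n : ℝ) / (2 * a) ≤ ((n / a : ℕ) : ℝ) := by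
  have h1 : n < a * (n / a) + a := Nat.lt_mul_div_succ n ha
  have h2 : 1 ≤ n / a := (Nat.one_le_div_iff ha).2 hn
  have h3 : n ≤ (n / a) * (2 * a) := by nlinarith
  rw [div_le_iff₀ (by positivity)]
  exact_mod_cast h3

lemma exists_variance_ge (p : ℕ) (x : Fin (p + 1) → Bool) : ∃ c : ℝ, 0 < c ∧
    ∀ᶠ n : ℕ in atTop, c * (n : ℝ) ^ (2 * p + 1) ≤
      expectUnif n (fun y => (∑ π ∈ embeddings (p + 1) n, centredOccurs x π y) ^ 2) := by
  obtain ⟨M, hM⟩ : ∃ M, M = p + 1 := ⟨_, rfl⟩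
  set L : ℕ := 2 * M ^ 2 * (2 * M) ^ p with hL
  have hMpos : 0 < M := by omega
  have hLpos : 0 < L := by positivity
  set κ : ℝ := 1 / (2 * (2 * M) ^ p) with hκ
  have hκpos : 0 < κ := by positivity
  refine ⟨((1 / 2) ^ (p + 1) * κ) ^ 2 / (2 * L), by positivity, ?_⟩
  filter_upwards [eventually_ge_atTop L] with n hn
  have hML : M ≤ L := by
    rw [hL]
    have : 1 ≤ (2 * M) ^ p := Nat.one_le_pow _ _ (by omega)
    nlinarith
  have hMn : M ≤ n := hML.trans hn
  have hnpos : (0 : ℝ) < n := by exact_mod_cast hLpos.trans_le hn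
  set K : ℕ := n / L with hK
  set b : ℕ := n / M with hb
  have hKb : K ≤ b := Nat.div_le_div_left hML hMpos
  have hKn : K ≤ n := Nat.div_le_self _ _
  have hKlow : (n : ℝ) / (2 * L) ≤ K := half_div_le_natCast_div hLpos hn
  have hblow : (n : ℝ) / (2 * M) ≤ b := half_div_le_natCast_div hMpos hMn
  have hKup : (K : ℝ) * L ≤ n := by exact_mod_cast Nat.div_mul_le_self n L
  have hKpos : (0 : ℝ) < K := lt_of_lt_of_le (by positivity) hKlow
  have hs : (K : ℝ) * (n / (2 * M)) ^ p ≤ (singleInitial p n K).card := by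
    have h1 : (K : ℝ) * b ^ p ≤ (singleInitial p n K).card := by
      exact_mod_cast le_card_singleInitial hKb (by rw [← hM]; exact Nat.mul_div_le n M)
    refine le_trans ?_ h1
    gcongr
  have hm : (M : ℝ) * (multipleInitial p n K).card ≤ κ * (K * n ^ p) := by
    have h1 : ((multipleInitial p n K).card : ℝ) * n ≤ p * (K ^ 2 * n ^ p) := by
      exact_mod_cast card_multipleInitial_mul_le hKn
    have h2 : (p : ℝ) ≤ M := by rw [hM]; push_cast; linarith
    have h3 : (M : ℝ) ^ 2 = κ * L := by
      rw [hκ, hL]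
      push_cast
      field_simp
    refine le_of_mul_le_mul_right ?_ hnpos
    calc (M : ℝ) * (multipleInitial p n K).card * n
        = M * ((multipleInitial p n K).card * n) := by ring
      _ ≤ M * (M * (K ^ 2 * n ^ p)) := by
          refine mul_le_mul_of_nonneg_left (h1.trans ?_) (by positivity)
          gcongr
      _ = κ * (K * n ^ p) * (K * L) := by linear_combination (K ^ 2 * n ^ p : ℝ) * h3
      _ ≤ κ * (K * n ^ p) * n := by gcongr
  have hdiff : κ * (K * n ^ p) ≤
      (singleInitial p n K).card - (p + 1) * (multipleInitial p n K).card := by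
    have h1 : (K : ℝ) * (n / (2 * M)) ^ p = 2 * (κ * (K * n ^ p)) := by
      rw [hκ, div_pow]
      field_simp
    have h2 : (M : ℝ) = p + 1 := by rw [hM]; push_cast; rfl
    rw [h2] at hm
    linarith
  have hnn : 0 ≤ κ * (K * (n : ℝ) ^ p) := by positivity
  have hV := variance_lower_bound x hKn (hnn.trans hdiff)
  refine le_of_mul_le_mul_right (le_trans ?_ hV) hKpos
  calc _ = ((1 / 2) ^ (p + 1) * κ) ^ 2 * (n / (2 * L)) * K * (n ^ p) ^ 2 := by ring
    _ ≤ ((1 / 2) ^ (p + 1) * κ) ^ 2 * K * K * (n ^ p) ^ 2 := by gcongr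
    _ = ((1 / 2) ^ (p + 1) * (κ * (K * n ^ p))) ^ 2 := by ring
    _ ≤ _ := by gcongr

end Occurrences

/-- The moments of the normalized occurrence count `(Ω_n(x) − E[Ω_n(x)])/√(Var[Ω_n(x)])`
converge to the moments of the standard normal distribution: `0` for odd `r`, and the
double factorial `(r−1)‼ = (r−1)(r−3)⋯1` for even `r` (which is `1` for `r = 0`). -/
theorem normalized_moments_tendsto (m : ℕ) (hm : 0 < m) (x : Fin m → Bool) (r : ℕ) :
    Filter.Tendsto
      (fun n : ℕ => expectUnif n (fun y =>
        (((omega x y : ℝ) - expectUnif n (fun y' => (omega x y' : ℝ))) /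
            Real.sqrt (varUnif n (fun y' => (omega x y' : ℝ)))) ^ r))
      Filter.atTop
      (nhds (if Even r then ((r - 1).doubleFactorial : ℝ) else 0)) := by
  obtain ⟨p, rfl⟩ := Nat.exists_eq_succ_of_ne_zero hm.ne'
  obtain ⟨c, hc, hcV⟩ := exists_variance_ge p x
  have hpos : ∀ᶠ n : ℕ in atTop, (0 : ℝ) < n := by
    filter_upwards [eventually_gt_atTop 0] with n hn
    exact_mod_cast hn
  have hsq : ∀ n : ℕ, ((p + 1) * (n : ℝ) ^ p * √n) ^ 2 = (p + 1) ^ 2 * (n : ℝ) ^ (2 * p + 1) :=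
    fun n => by
      rw [mul_pow, Real.sq_sqrt (Nat.cast_nonneg n)]
      ring
  have hlim := IsLocallyDependent.tendsto_moment (c := c / (p + 1) ^ 2)
    (s := fun n : ℕ => (p + 1) * (n : ℝ) ^ p * √n) (by positivity)
    (fun n => isLocallyDependent_centredOccurs p n x)
    (by
      filter_upwards [hpos] with n hn
      positivity)
    (fun n => by
      rw [hsq]
      exact le_of_eq (by ring))
    (by
      filter_upwards [hcV] with n hn
      refine le_trans (le_of_eq ?_) hn
      rw [hsq]
      field_simp)
    (by
      have h1 : Tendsto (fun n : ℕ => ((p : ℝ) + 1) / √n) atTop (nhds 0) :=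
        (Real.tendsto_sqrt_atTop.comp tendsto_natCast_atTop_atTop).const_div_atTop _
      refine h1.congr' ?_
      filter_upwards [hpos] with n hn
      have : 0 < √(n : ℝ) := Real.sqrt_pos.2 hn
      field_simp) r
  refine hlim.congr fun n => ?_
  simp only [varUnif, omega_sub_expect_eq_sum, div_eq_mul_inv, mul_pow]
  rw [expectUnif_mul_const, inv_pow]
end

section
/- For all real numbers E > 0 and 0 ≤ ω < E/2, the Taylor remainder satisfies R(ω) := ∫_E^ω (ω − t)³/(3t³) dt ≤ E/6 + 2(ω − E)⁴/(3E³). -/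
/-- On `(ω, E]` with `ω ≥ 0`, the remainder integrand is largest in absolute value at `t = E`. -/
theorem norm_taylor_remainder_integrand_le {E ω t : ℝ} (hω0 : 0 ≤ ω) (hωt : ω < t) (htE : t ≤ E) :
    ‖(ω - t) ^ 3 / (3 * t ^ 3)‖ ≤ (E - ω) ^ 3 / (3 * E ^ 3) := by
  have ht : 0 < t := hω0.trans_lt hωt
  have hE : 0 < E := ht.trans_le htE
  have hratio : (t - ω) / t ≤ (E - ω) / E := by
    rw [div_le_div_iff₀ ht hE]
    nlinarith [mul_le_mul_of_nonneg_left htE hω0]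
  have hnonneg : 0 ≤ (t - ω) / t := div_nonneg (sub_nonneg.2 hωt.le) ht.le
  have hcube := pow_le_pow_left₀ hnonneg hratio 3
  have hnorm : ‖(ω - t) ^ 3 / (3 * t ^ 3)‖ = ((t - ω) / t) ^ 3 / 3 := by
    rw [norm_div, norm_pow, norm_mul, norm_pow, Real.norm_eq_abs (ω - t), abs_sub_comm,
      abs_of_pos (sub_pos.2 hωt), Real.norm_of_nonneg ht.le, Real.norm_of_nonneg zero_le_three,
      div_pow, div_div, mul_comm]
  calc ‖(ω - t) ^ 3 / (3 * t ^ 3)‖ = ((t - ω) / t) ^ 3 / 3 := hnorm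
    _ ≤ ((E - ω) / E) ^ 3 / 3 := by gcongr
    _ = (E - ω) ^ 3 / (3 * E ^ 3) := by rw [div_pow, div_div, mul_comm]

/-- For `E > 0` and `0 ≤ ω < E/2`, the Taylor remainder satisfies
`∫_E^ω (ω − t)³/(3t³) dt ≤ E/6 + 2(ω − E)⁴/(3E³)`. -/
theorem taylor_remainder_le_small (E ω : ℝ) (hE : 0 < E) (hω0 : 0 ≤ ω) (hω : ω < E / 2) :
    (∫ t in E..ω, (ω - t) ^ 3 / (3 * t ^ 3)) ≤ E / 6 + 2 * (ω - E) ^ 4 / (3 * E ^ 3) := by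
  have hωE : ω ≤ E := by linarith
  have hbound : ‖∫ t in E..ω, (ω - t) ^ 3 / (3 * t ^ 3)‖ ≤
      (E - ω) ^ 3 / (3 * E ^ 3) * |ω - E| := by
    refine intervalIntegral.norm_integral_le_of_norm_le_const fun t ht => ?_
    rw [Set.uIoc_of_ge hωE] at ht
    exact norm_taylor_remainder_integrand_le hω0 ht.1 ht.2
  have heq : (E - ω) ^ 3 / (3 * E ^ 3) * |ω - E| = (ω - E) ^ 4 / (3 * E ^ 3) := by
    rw [abs_sub_comm, abs_of_nonneg (sub_nonneg.2 hωE)]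
    ring
  have hpos : 0 ≤ (ω - E) ^ 4 / (3 * E ^ 3) := by positivity
  calc (∫ t in E..ω, (ω - t) ^ 3 / (3 * t ^ 3)) ≤ (ω - E) ^ 4 / (3 * E ^ 3) :=
        (Real.le_norm_self _).trans (hbound.trans_eq heq)
    _ ≤ E / 6 + 2 * (ω - E) ^ 4 / (3 * E ^ 3) := by
        rw [mul_div_assoc]
        linarith
end

section
/- Let Ω be a nonnegative real-valued random variable with finite fourth moment and mean E := E[Ω] > 0, and define the Taylor remainder R(ω) := ∫_E^ω (ω − t)³/(3t³) dt for ω ≥ 0. Then 0 ≤ E[R(Ω)] ≤ (10/3) · E[(Ω − E)⁴]/E³. -/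
open MeasureTheory

/-- The Taylor remainder `∫_E^ω (ω − t)³/(3t³) dt` is nonnegative for `ω ≥ 0` and `E > 0`. -/
lemma taylor_remainder_nonneg {E ω : ℝ} (hE : 0 < E) (hω : 0 ≤ ω) :
    0 ≤ ∫ t in E..ω, (ω - t) ^ 3 / (3 * t ^ 3) := by
  rcases le_total E ω with h | h
  · refine intervalIntegral.integral_nonneg h fun t ht => ?_
    have h1 : 0 ≤ ω - t := sub_nonneg.2 ht.2
    have h2 : 0 ≤ t := hE.le.trans ht.1
    positivity
  · rw [intervalIntegral.integral_symm, ← intervalIntegral.integral_neg]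
    refine intervalIntegral.integral_nonneg h fun t ht => ?_
    have h1 : 0 ≤ t - ω := sub_nonneg.2 ht.1
    have h2 : 0 ≤ t := hω.trans ht.1
    have h3 : -((ω - t) ^ 3 / (3 * t ^ 3)) = (t - ω) ^ 3 / (3 * t ^ 3) := by ring
    rw [h3]
    positivity

/-- The Taylor remainder is at most `(ω − E)⁴/(3E³)`, since `|ω − t|/t ≤ |ω − E|/E` for every
`t` between `E` and `ω`. -/
lemma taylor_remainder_le {E ω : ℝ} (hE : 0 < E) (hω : 0 ≤ ω) :
    (∫ t in E..ω, (ω - t) ^ 3 / (3 * t ^ 3)) ≤ (ω - E) ^ 4 / (3 * E ^ 3) := by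
  have key : ∀ t ∈ Set.uIoc E ω,
      ‖(ω - t) ^ 3 / (3 * t ^ 3)‖ ≤ (|ω - E| / E) ^ 3 / 3 := by
    intro t ht
    have ht0 : 0 < t := (le_min hE.le hω).trans_lt ht.1
    have hratio : |ω - t| / t ≤ |ω - E| / E := by
      rw [div_le_div_iff₀ ht0 hE]
      rcases Set.mem_uIoc.1 ht with ⟨h1, h2⟩ | ⟨h1, h2⟩
      · rw [abs_of_nonneg (by linarith), abs_of_nonneg (by linarith)]
        nlinarith
      · rw [abs_of_nonpos (by linarith), abs_of_nonpos (by linarith)]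
        nlinarith
    calc ‖(ω - t) ^ 3 / (3 * t ^ 3)‖ = (|ω - t| / t) ^ 3 / 3 := by
          rw [Real.norm_eq_abs, abs_div, abs_mul, abs_pow, abs_pow, abs_of_pos ht0,
            abs_of_pos (three_pos : (0 : ℝ) < 3)]
          field_simp
      _ ≤ (|ω - E| / E) ^ 3 / 3 := by gcongr
  calc (∫ t in E..ω, (ω - t) ^ 3 / (3 * t ^ 3))
      ≤ ‖∫ t in E..ω, (ω - t) ^ 3 / (3 * t ^ 3)‖ := Real.le_norm_self _
    _ ≤ (|ω - E| / E) ^ 3 / 3 * |ω - E| :=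
        intervalIntegral.norm_integral_le_of_norm_le_const key
    _ = |ω - E| ^ 4 / (3 * E ^ 3) := by field_simp
    _ = (ω - E) ^ 4 / (3 * E ^ 3) := by rw [Even.pow_abs (by decide)]

/-- For a nonnegative real random variable `Ω` with finite fourth moment and mean `E > 0`,
the expected Taylor remainder `R(ω) = ∫_E^ω (ω − t)³/(3t³) dt` satisfies
`0 ≤ E[R(Ω)] ≤ (10/3) E[(Ω − E)⁴]/E³`. -/
theorem expected_taylor_remainder_bound {α : Type*} [MeasurableSpace α] (μ : Measure α)
    [IsProbabilityMeasure μ] (X : α → ℝ) (hX : Measurable X) (hpos : ∀ a, 0 ≤ X a)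
    (hint : Integrable X μ) (E : ℝ) (hEdef : E = ∫ a, X a ∂μ) (hE : 0 < E)
    (hint4 : Integrable (fun a => (X a - E) ^ 4) μ) :
    0 ≤ (∫ a, (∫ t in E..(X a), (X a - t) ^ 3 / (3 * t ^ 3)) ∂μ) ∧
    (∫ a, (∫ t in E..(X a), (X a - t) ^ 3 / (3 * t ^ 3)) ∂μ) ≤
      (10 / 3) * (∫ a, (X a - E) ^ 4 ∂μ) / E ^ 3 := by
  refine ⟨integral_nonneg fun a => taylor_remainder_nonneg hE (hpos a), ?_⟩
  have hmono : (∫ a, (∫ t in E..(X a), (X a - t) ^ 3 / (3 * t ^ 3)) ∂μ) ≤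
      ∫ a, (X a - E) ^ 4 / (3 * E ^ 3) ∂μ :=
    integral_mono_of_nonneg (ae_of_all _ fun a => taylor_remainder_nonneg hE (hpos a))
      (hint4.div_const _) (ae_of_all _ fun a => taylor_remainder_le hE (hpos a))
  have hfourth : 0 ≤ ∫ a, (X a - E) ^ 4 ∂μ := integral_nonneg fun a => by positivity
  calc (∫ a, (∫ t in E..(X a), (X a - t) ^ 3 / (3 * t ^ 3)) ∂μ)
      ≤ ∫ a, (X a - E) ^ 4 / (3 * E ^ 3) ∂μ := hmono
    _ = (1 / 3) * (∫ a, (X a - E) ^ 4 ∂μ) / E ^ 3 := by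
        rw [integral_div]
        field_simp
    _ ≤ (10 / 3) * (∫ a, (X a - E) ^ 4 ∂μ) / E ^ 3 := by
        gcongr
        norm_num
end

section
/- Let Ω be a nonnegative real-valued random variable with finite fourth moment and mean E := E[Ω] > 0, with the convention 0·ln 0 := 0. Then |E[Ω ln Ω] − (E·ln E + Var(Ω)/(2E) − E[(Ω − E)³]/(6E²))| ≤ (10/3) · E[(Ω − E)⁴]/E³. -/
open MeasureTheory

/-- A differentiable function on `(0, ∞)` whose derivative has the sign of `y - 1` is minimal
at `1`. -/
lemma le_of_hasDerivAt_mul_sub_one_nonneg {g g' : ℝ → ℝ}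
    (hg : ∀ y, 0 < y → HasDerivAt g (g' y) y) (hs : ∀ y, 0 < y → 0 ≤ g' y * (y - 1))
    {y : ℝ} (hy : 0 < y) : g 1 ≤ g y := by
  rcases lt_trichotomy y 1 with h | rfl | h
  · obtain ⟨c, hc, hc'⟩ := exists_hasDerivAt_eq_slope g g' h
      (fun z hz => (hg z (hy.trans_le hz.1)).continuousAt.continuousWithinAt)
      (fun z hz => hg z (hy.trans hz.1))
    have hc1 := hs c (hy.trans hc.1)
    have hd : g' c ≤ 0 := by
      by_contra! hn
      nlinarith [hc.2, mul_pos hn (sub_pos.2 hc.2)]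
    rw [eq_div_iff (by linarith)] at hc'
    nlinarith
  · exact le_rfl
  · obtain ⟨c, hc, hc'⟩ := exists_hasDerivAt_eq_slope g g' h
      (fun z hz => (hg z (one_pos.trans_le hz.1)).continuousAt.continuousWithinAt)
      (fun z hz => hg z (one_pos.trans hz.1))
    have hc1 := hs c (one_pos.trans hc.1)
    have hd : 0 ≤ g' c := nonneg_of_mul_nonneg_left hc1 (sub_pos.2 hc.1)
    rw [eq_div_iff (by linarith)] at hc'
    nlinarith

/-- Third-order Taylor lower bound for `y log y` at `1`. -/
lemma taylor_le_mul_log {y : ℝ} (hy : 0 ≤ y) :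
    (y - 1) + (y - 1) ^ 2 / 2 - (y - 1) ^ 3 / 6 ≤ y * Real.log y := by
  rcases hy.eq_or_lt with rfl | hy
  · norm_num
  have key := le_of_hasDerivAt_mul_sub_one_nonneg
    (g := fun y => Real.log y - ((y - 1) + (y - 1) ^ 2 / 2 - (y - 1) ^ 3 / 6) / y)
    (g' := fun y => (y - 1) ^ 3 / (3 * y ^ 2)) (fun z hz => ?_) (fun z hz => ?_) hy
  · simp only [Real.log_one] at key
    norm_num at key
    rw [div_le_iff₀ hy] at key
    linarith
  · have hl : HasDerivAt (fun y : ℝ => y - 1) 1 z := (hasDerivAt_id z).sub_const 1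
    refine ((Real.hasDerivAt_log hz.ne').sub (((hl.add ((hl.pow 2).div_const 2)).sub
      ((hl.pow 3).div_const 6)).div (hasDerivAt_id z) hz.ne')).congr_deriv ?_
    simp
    field_simp
    ring
  · have : (z - 1) ^ 3 / (3 * z ^ 2) * (z - 1) = (z - 1) ^ 4 / (3 * z ^ 2) := by ring
    simp only [this]
    positivity

/-- Third-order Taylor upper bound for `y log y` at `1`, with quartic error. -/
lemma mul_log_le_taylor {y : ℝ} (hy : 0 ≤ y) :
    y * Real.log y ≤
      (y - 1) + (y - 1) ^ 2 / 2 - (y - 1) ^ 3 / 6 + (y - 1) ^ 4 / 3 := by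
  rcases hy.eq_or_lt with rfl | hy
  · norm_num
  have key := le_of_hasDerivAt_mul_sub_one_nonneg
    (g := fun y => ((y - 1) + (y - 1) ^ 2 / 2 - (y - 1) ^ 3 / 6 + (y - 1) ^ 4 / 3) / y
      - Real.log y)
    (g' := fun y => (y - 1) ^ 3 / y) (fun z hz => ?_) (fun z hz => ?_) hy
  · simp only [Real.log_one] at key
    norm_num at key
    rw [le_div_iff₀ hy] at key
    linarith
  · have hl : HasDerivAt (fun y : ℝ => y - 1) 1 z := (hasDerivAt_id z).sub_const 1
    refine (((((hl.add ((hl.pow 2).div_const 2)).sub ((hl.pow 3).div_const 6)).add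
      ((hl.pow 4).div_const 3)).div (hasDerivAt_id z) hz.ne').sub
      (Real.hasDerivAt_log hz.ne')).congr_deriv ?_
    simp
    field_simp
    ring
  · have : (z - 1) ^ 3 / z * (z - 1) = (z - 1) ^ 4 / z := by ring
    simp only [this]
    positivity

/-- The remainder of the third-order Taylor expansion of `x log x` at `E > 0`. -/
lemma mul_log_sub_taylor_mem_Icc {x E : ℝ} (hx : 0 ≤ x) (hE : 0 < E) :
    x * Real.log x - (E * Real.log E + (Real.log E + 1) * (x - E) + (x - E) ^ 2 / (2 * E)
      - (x - E) ^ 3 / (6 * E ^ 2)) ∈ Set.Icc 0 ((x - E) ^ 4 / (3 * E ^ 3)) := by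
  obtain ⟨y, hy, rfl⟩ : ∃ y, 0 ≤ y ∧ x = E * y :=
    ⟨x / E, by positivity, by field_simp⟩
  have hlog : E * y * Real.log (E * y) = E * y * Real.log E + E * (y * Real.log y) := by
    rcases hy.eq_or_lt with rfl | hy
    · simp
    · rw [Real.log_mul hE.ne' hy.ne']
      ring
  have hrem : E * y * Real.log (E * y) - (E * Real.log E + (Real.log E + 1) * (E * y - E)
      + (E * y - E) ^ 2 / (2 * E) - (E * y - E) ^ 3 / (6 * E ^ 2))
      = E * (y * Real.log y - ((y - 1) + (y - 1) ^ 2 / 2 - (y - 1) ^ 3 / 6)) := by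
    rw [hlog]
    field_simp
    ring
  have hquart : (E * y - E) ^ 4 / (3 * E ^ 3) = E * ((y - 1) ^ 4 / 3) := by
    field_simp
  rw [hrem, hquart]
  exact ⟨mul_nonneg hE.le (sub_nonneg.2 (taylor_le_mul_log hy)),
    mul_le_mul_of_nonneg_left (by linarith [mul_log_le_taylor hy]) hE.le⟩

/-- For a nonnegative real random variable `Ω` with finite fourth moment and mean `E > 0`
(with the convention `0 · ln 0 = 0`, automatic since `Real.log 0 = 0`):
`|E[Ω ln Ω] − (E ln E + Var(Ω)/(2E) − E[(Ω − E)³]/(6E²))| ≤ (10/3) E[(Ω − E)⁴]/E³`. -/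
theorem expected_mul_log_estimate {α : Type*} [MeasurableSpace α] (μ : Measure α)
    [IsProbabilityMeasure μ] (X : α → ℝ) (hX : Measurable X) (hpos : ∀ a, 0 ≤ X a)
    (hint : Integrable X μ) (E : ℝ) (hEdef : E = ∫ a, X a ∂μ) (hE : 0 < E)
    (hint4 : Integrable (fun a => (X a - E) ^ 4) μ) :
    |(∫ a, X a * Real.log (X a) ∂μ) -
        (E * Real.log E + (∫ a, (X a - E) ^ 2 ∂μ) / (2 * E) -
          (∫ a, (X a - E) ^ 3 ∂μ) / (6 * E ^ 2))| ≤
      (10 / 3) * (∫ a, (X a - E) ^ 4 ∂μ) / E ^ 3 := by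
  have hm : Measurable (fun a => X a - E) := hX.sub_const E
  have hdom : Integrable (fun a => 1 + (X a - E) ^ 4) μ := (integrable_const 1).add hint4
  have h1 : Integrable (fun a => X a - E) μ := hint.sub (integrable_const E)
  have h2 : Integrable (fun a => (X a - E) ^ 2) μ := by
    refine hdom.mono' (hm.pow_const 2).aestronglyMeasurable (.of_forall fun a => ?_)
    rw [Real.norm_of_nonneg (sq_nonneg _)]
    nlinarith [sq_nonneg ((X a - E) ^ 2 - 1)]
  have h3 : Integrable (fun a => (X a - E) ^ 3) μ := by
    refine hdom.mono' (hm.pow_const 3).aestronglyMeasurable (.of_forall fun a => ?_)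
    rw [Real.norm_eq_abs, abs_le]
    constructor <;>
      nlinarith [sq_nonneg ((X a - E) ^ 2 - 1), sq_nonneg ((X a - E) ^ 2 + (X a - E)),
        sq_nonneg ((X a - E) ^ 2 - (X a - E))]
  have hcentered : ∫ a, (X a - E) ∂μ = 0 := by
    rw [integral_sub hint (integrable_const E), ← hEdef]
    simp
  have hlin : Integrable (fun a => E * Real.log E + (Real.log E + 1) * (X a - E)) μ :=
    (integrable_const _).add (h1.const_mul _)
  have hquad : Integrable (fun a => E * Real.log E + (Real.log E + 1) * (X a - E)
      + (X a - E) ^ 2 / (2 * E)) μ := hlin.add (h2.div_const _)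
  have htaylor : Integrable (fun a => E * Real.log E + (Real.log E + 1) * (X a - E)
      + (X a - E) ^ 2 / (2 * E) - (X a - E) ^ 3 / (6 * E ^ 2)) μ := hquad.sub (h3.div_const _)
  have hrem : Integrable (fun a => X a * Real.log (X a) - (E * Real.log E
      + (Real.log E + 1) * (X a - E) + (X a - E) ^ 2 / (2 * E)
      - (X a - E) ^ 3 / (6 * E ^ 2))) μ := by
    refine (hint4.div_const (3 * E ^ 3)).mono' ?_ (.of_forall fun a => ?_)
    · exact (hX.mul hX.log).aestronglyMeasurable.sub htaylor.aestronglyMeasurable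
    · have h := mul_log_sub_taylor_mem_Icc (hpos a) hE
      rw [Real.norm_of_nonneg h.1]
      exact h.2
  have hlog : Integrable (fun a => X a * Real.log (X a)) μ := by
    refine (hrem.add htaylor).congr (.of_forall fun a => ?_)
    simp only [Pi.add_apply, sub_add_cancel]
  have heq : (∫ a, X a * Real.log (X a) ∂μ) -
      (E * Real.log E + (∫ a, (X a - E) ^ 2 ∂μ) / (2 * E) -
        (∫ a, (X a - E) ^ 3 ∂μ) / (6 * E ^ 2))
      = ∫ a, (X a * Real.log (X a) - (E * Real.log E + (Real.log E + 1) * (X a - E)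
        + (X a - E) ^ 2 / (2 * E) - (X a - E) ^ 3 / (6 * E ^ 2))) ∂μ := by
    rw [integral_sub hlog htaylor, integral_sub hquad (h3.div_const _),
      integral_add hlin (h2.div_const _), integral_add (integrable_const _) (h1.const_mul _),
      integral_const_mul (Real.log E + 1), hcentered, integral_div, integral_div]
    simp
  have hnonneg : 0 ≤ (∫ a, (X a - E) ^ 4 ∂μ) / E ^ 3 :=
    div_nonneg (integral_nonneg fun a => by positivity) (by positivity)
  rw [heq, abs_of_nonneg (integral_nonneg fun a =>
    (mul_log_sub_taylor_mem_Icc (hpos a) hE).1)]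
  calc
    _ ≤ ∫ a, (X a - E) ^ 4 / (3 * E ^ 3) ∂μ :=
      integral_mono hrem (hint4.div_const _) fun a =>
        (mul_log_sub_taylor_mem_Icc (hpos a) hE).2
    _ = (1 / 3) * ((∫ a, (X a - E) ^ 4 ∂μ) / E ^ 3) := by
      rw [integral_div]
      field_simp
    _ ≤ (10 / 3) * ((∫ a, (X a - E) ^ 4 ∂μ) / E ^ 3) := by
      gcongr
      norm_num
    _ = _ := by rw [mul_div_assoc]
end

section
/- For every positive integer m there exists N such that for all n > N and every binary string x ∈ {0,1}^m, the entropy satisfies H_n(x) ≥ H_n(0^m), with equality only if x = 0^m or x = 1^m (i.e., H_n(x) > H_n(0^m) whenever x is not constant). -/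
/-- `μ_{n,m} = C(n,m) · 2^{n−m}`, the total mask count. -/
def mu (n m : ℕ) : ℕ := Nat.choose n m * 2 ^ (n - m)

/-- The entropy `H_n(x) = −Σ_y p_y log₂ p_y` with `p_y = ω_x(y)/μ_{n,m}`
(note `Real.logb 2 0 = 0`, so the convention `0·log₂ 0 = 0` holds automatically). -/
noncomputable def Hent (m n : ℕ) (x : Fin m → Bool) : ℝ :=
  -∑ y : Fin n → Bool,
      ((omega x y : ℝ) / (mu n m : ℝ)) * Real.logb 2 ((omega x y : ℝ) / (mu n m : ℝ))

open Finset

/-- Appending one symbol to `y`: an embedding of `x` either avoids the new position, or uses it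
for the last symbol of `x`. -/
lemma omega_snoc {m n : ℕ} (x : Fin (m + 1) → Bool) (y : Fin n → Bool) (b : Bool) :
    omega x (Fin.snoc y b : Fin (n + 1) → Bool) =
      omega x y + if x (Fin.last m) = b then omega (Fin.init x) y else 0 := by
  have hlast : (if x (Fin.last m) = b then omega (Fin.init x) y else 0) =
      Nat.card {π : Fin m → Fin n //
        (StrictMono π ∧ ∀ j, y (π j) = Fin.init x j) ∧ x (Fin.last m) = b} := by
    split_ifs with h
    · simp [omega, h]
    · simp [h]
  rw [hlast, omega, omega, ← Nat.card_sum]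
  symm
  refine Nat.card_eq_of_bijective (Sum.elim
    (fun π => ⟨fun i => (π.1 i).castSucc, ?_, ?_⟩)
    (fun π => ⟨Fin.snoc (fun i => (π.1 i).castSucc) (Fin.last n), ?_, ?_⟩)) ⟨?_, ?_⟩
  · exact fun i j h => Fin.castSucc_lt_castSucc_iff.2 (π.2.1 h)
  · intro j
    simpa using π.2.2 j
  · intro i j h
    induction j using Fin.lastCases with
    | last =>
      induction i using Fin.lastCases with
      | last => exact absurd h (lt_irrefl _)
      | cast i => simp [Fin.castSucc_lt_last]
    | cast j =>
      induction i using Fin.lastCases with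
      | last => exact absurd h (not_lt.2 (Fin.le_last _))
      | cast i =>
        simpa using π.2.1.1 (Fin.castSucc_lt_castSucc_iff.1 h)
  · intro j
    induction j using Fin.lastCases with
    | last => simpa using π.2.2.symm
    | cast j => simpa [Fin.init] using π.2.1.2 j
  · rintro (⟨π, hπ⟩ | ⟨π, hπ⟩) (⟨ρ, hρ⟩ | ⟨ρ, hρ⟩) h
    · simp only [Sum.elim_inl, Subtype.mk.injEq] at h
      have : π = ρ := funext fun i => Fin.castSucc_injective _ (congrFun h i)
      simp [this]
    · simp only [Sum.elim_inl, Sum.elim_inr, Subtype.mk.injEq] at h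
      have := congrFun h (Fin.last m)
      simp only [Fin.snoc_last] at this
      exact absurd this (Fin.castSucc_lt_last _).ne
    · simp only [Sum.elim_inl, Sum.elim_inr, Subtype.mk.injEq] at h
      have := congrFun h (Fin.last m)
      simp only [Fin.snoc_last] at this
      exact absurd this.symm (Fin.castSucc_lt_last _).ne
    · simp only [Sum.elim_inr, Subtype.mk.injEq] at h
      have : π = ρ := funext fun i => Fin.castSucc_injective _ (by
        simpa using congrFun h i.castSucc)
      simp [this]
  · rintro ⟨π, hπ, hy⟩
    by_cases h : π (Fin.last m) = Fin.last n
    · have hne : ∀ i : Fin m, π i.castSucc ≠ Fin.last n := fun i hi =>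
        absurd (hπ (Fin.castSucc_lt_last i)) (by rw [hi, h]; exact lt_irrefl _)
      refine ⟨Sum.inr ⟨fun i => (π i.castSucc).castPred (hne i), ⟨?_, ?_⟩, ?_⟩, ?_⟩
      · intro i j hij
        simpa using hπ (Fin.castSucc_lt_castSucc_iff.2 hij)
      · intro j
        have := hy j.castSucc
        rw [← Fin.castSucc_castPred _ (hne j), Fin.snoc_castSucc] at this
        exact this
      · have := hy (Fin.last m)
        rw [h, Fin.snoc_last] at this
        exact this.symm
      · simp only [Sum.elim_inr, Subtype.mk.injEq]
        funext i
        induction i using Fin.lastCases with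
        | last => simp [h]
        | cast i => simp
    · have hne : ∀ i, π i ≠ Fin.last n := fun i hi => h (by
        have := hπ.monotone (Fin.le_last i)
        rw [hi] at this
        exact le_antisymm (Fin.le_last _) this)
      refine ⟨Sum.inl ⟨fun i => (π i).castPred (hne i), ?_, ?_⟩, ?_⟩
      · intro i j hij
        simpa using hπ hij
      · intro j
        have := hy j
        rw [← Fin.castSucc_castPred _ (hne j), Fin.snoc_castSucc] at this
        exact this
      · simp

/-- The numbers of embeddings into `y` of the prefixes of the infinite string `X`. -/
noncomputable def prefixCount (X : ℕ → Bool) {n : ℕ} (y : Fin n → Bool) (j : ℕ) : ℝ :=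
  omega (fun i : Fin j => X i) y

/-- The increment of the prefix counts `A` of `X` when the symbol `b` is appended. -/
def increment (X : ℕ → Bool) (b : Bool) (A : ℕ → ℝ) : ℕ → ℝ
  | 0 => 0
  | j + 1 => if X j = b then A j else 0

/-- The increment of the prefix counts `A` of a constant string when its symbol is appended. -/
def rightShift (A : ℕ → ℝ) : ℕ → ℝ
  | 0 => 0
  | j + 1 => A j

lemma rightShift_add (A B : ℕ → ℝ) : rightShift (A + B) = rightShift A + rightShift B := by
  funext j
  cases j <;> simp [rightShift]

lemma rightShift_nonneg {A : ℕ → ℝ} (hA : 0 ≤ A) : 0 ≤ rightShift A := by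
  intro j
  cases j with
  | zero => simp [rightShift]
  | succ j => exact hA j

lemma increment_nonneg (X : ℕ → Bool) (b : Bool) {A : ℕ → ℝ} (hA : 0 ≤ A) :
    0 ≤ increment X b A := by
  intro j
  cases j with
  | zero => simp [increment]
  | succ j =>
    simp only [increment]
    split_ifs
    · exact hA j
    · simp

lemma increment_false_add_true (X : ℕ → Bool) (A : ℕ → ℝ) :
    increment X false A + increment X true A = rightShift A := by
  funext j
  cases j with
  | zero => simp [increment, rightShift]
  | succ j => cases h : X j <;> simp [increment, rightShift, h]

lemma prefixCount_nonneg (X : ℕ → Bool) {n : ℕ} (y : Fin n → Bool) : 0 ≤ prefixCount X y :=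
  fun _ => Nat.cast_nonneg _

lemma prefixCount_snoc (X : ℕ → Bool) {n : ℕ} (y : Fin n → Bool) (b : Bool) :
    prefixCount X (Fin.snoc y b : Fin (n + 1) → Bool) =
      prefixCount X y + increment X b (prefixCount X y) := by
  funext j
  cases j with
  | zero =>
    have key : ∀ {k : ℕ} (z : Fin k → Bool), omega (fun i : Fin 0 => X i) z = 1 := by
      intro k z
      rw [omega, Nat.card_eq_one_iff_unique]
      exact ⟨⟨fun a b => Subtype.ext (Subsingleton.elim _ _)⟩,
        ⟨⟨Fin.elim0, fun i => i.elim0, fun i => i.elim0⟩⟩⟩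
    simp [prefixCount, increment, key]
  | succ j =>
    simp only [prefixCount, increment, Pi.add_apply, omega_snoc, Fin.val_last]
    push_cast
    rfl

/-- The sum of `φ` of the `m`-th prefix count over all ways to append `k` symbols, starting from
the counts `A`, when all symbols of the embedded string are equal. -/
def constantSum (φ : ℝ → ℝ) (m : ℕ) : ℕ → (ℕ → ℝ) → ℝ
  | 0, A => φ (A m)
  | k + 1, A => constantSum φ m k A + constantSum φ m k (A + rightShift A)

/-- The hybrid sum in which the first `n` symbols are matched against `X` and the last `k` ones
against a constant string. -/
noncomputable def hybridSum (φ : ℝ → ℝ) (m : ℕ) (X : ℕ → Bool) (n k : ℕ) : ℝ :=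
  ∑ y : Fin n → Bool, constantSum φ m k (prefixCount X y)

section Supermodular

variable {φ : ℝ → ℝ}

lemma StrictConvexOn.add_lt_add_Ici (hφ : StrictConvexOn ℝ (Set.Ici 0) φ) {a u v : ℝ}
    (ha : 0 ≤ a) (hu : 0 < u) (hv : 0 < v) :
    φ (a + u) + φ (a + v) < φ a + φ (a + u + v) := by
  have hs : 0 < u + v := add_pos hu hv
  have hmem : a ∈ Set.Ici (0 : ℝ) := ha
  have hmem' : a + u + v ∈ Set.Ici (0 : ℝ) := by simp only [Set.mem_Ici]; linarith
  have hne : a ≠ a + u + v := by linarith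
  have h1 := hφ.2 hmem hmem' hne (div_pos hv hs) (div_pos hu hs) (by field_simp; ring)
  have h2 := hφ.2 hmem hmem' hne (div_pos hu hs) (div_pos hv hs) (by field_simp)
  have e1 : (v / (u + v)) • a + (u / (u + v)) • (a + u + v) = a + u := by
    simp only [smul_eq_mul]; field_simp; ring
  have e2 : (u / (u + v)) • a + (v / (u + v)) • (a + u + v) = a + v := by
    simp only [smul_eq_mul]; field_simp; ring
  have e3 : (v / (u + v)) • φ a + (u / (u + v)) • φ (a + u + v) +
      ((u / (u + v)) • φ a + (v / (u + v)) • φ (a + u + v)) = φ a + φ (a + u + v) := by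
    simp only [smul_eq_mul]; field_simp; ring
  rw [e1] at h1
  rw [e2] at h2
  linarith

lemma StrictConvexOn.add_le_add_Ici (hφ : StrictConvexOn ℝ (Set.Ici 0) φ) {a u v : ℝ}
    (ha : 0 ≤ a) (hu : 0 ≤ u) (hv : 0 ≤ v) :
    φ (a + u) + φ (a + v) ≤ φ a + φ (a + u + v) := by
  rcases hu.eq_or_lt with rfl | hu
  · simp
  rcases hv.eq_or_lt with rfl | hv
  · simp [add_comm]
  exact (hφ.add_lt_add_Ici ha hu hv).le

lemma constantSum_supermodular (hφ : StrictConvexOn ℝ (Set.Ici 0) φ) (m k : ℕ)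
    {A u v : ℕ → ℝ} (hA : 0 ≤ A) (hu : 0 ≤ u) (hv : 0 ≤ v) :
    constantSum φ m k (A + u) + constantSum φ m k (A + v) ≤
      constantSum φ m k A + constantSum φ m k (A + u + v) := by
  induction k generalizing A u v with
  | zero => exact hφ.add_le_add_Ici (hA m) (hu m) (hv m)
  | succ k ih =>
    have h1 := ih hA hu hv
    have h2 := ih (add_nonneg hA (rightShift_nonneg hA)) (add_nonneg hu (rightShift_nonneg hu))
      (add_nonneg hv (rightShift_nonneg hv))
    simp only [constantSum, rightShift_add]
    simp only [add_add_add_comm A] at h2 ⊢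
    simp only [add_add_add_comm (A + u)] at h2 ⊢
    linarith

lemma exists_add_rightShift_pos {u : ℕ → ℝ} (hu : 0 ≤ u) {i m k : ℕ} (hi : i ≤ m)
    (hik : m ≤ i + (k + 1)) (hpos : 0 < u i) :
    ∃ j ≤ m, m ≤ j + k ∧ 0 < (u + rightShift u) j := by
  rcases hi.eq_or_lt with rfl | hi
  · exact ⟨i, le_rfl, by omega, add_pos_of_pos_of_nonneg hpos (rightShift_nonneg hu i)⟩
  · exact ⟨i + 1, hi, by omega, add_pos_of_nonneg_of_pos (hu _) hpos⟩

lemma constantSum_strict_supermodular (hφ : StrictConvexOn ℝ (Set.Ici 0) φ) {m k : ℕ}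
    {A u v : ℕ → ℝ} (hA : 0 ≤ A) (hu : 0 ≤ u) (hv : 0 ≤ v)
    (hu' : ∃ i ≤ m, m ≤ i + k ∧ 0 < u i) (hv' : ∃ i ≤ m, m ≤ i + k ∧ 0 < v i) :
    constantSum φ m k (A + u) + constantSum φ m k (A + v) <
      constantSum φ m k A + constantSum φ m k (A + u + v) := by
  induction k generalizing A u v with
  | zero =>
    obtain ⟨i, hi, hi', hui⟩ := hu'
    obtain ⟨j, hj, hj', hvj⟩ := hv'
    obtain rfl : i = m := le_antisymm hi hi'
    obtain rfl : j = i := le_antisymm hj hj'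
    exact hφ.add_lt_add_Ici (hA j) hui hvj
  | succ k ih =>
    obtain ⟨i, hi, hi', hui⟩ := hu'
    obtain ⟨j, hj, hj', hvj⟩ := hv'
    have h1 := constantSum_supermodular hφ m k hA hu hv
    have h2 := ih (add_nonneg hA (rightShift_nonneg hA)) (add_nonneg hu (rightShift_nonneg hu))
      (add_nonneg hv (rightShift_nonneg hv)) (exists_add_rightShift_pos hu hi hi' hui)
      (exists_add_rightShift_pos hv hj hj' hvj)
    simp only [constantSum, rightShift_add]
    simp only [add_add_add_comm A] at h2 ⊢
    simp only [add_add_add_comm (A + u)] at h2 ⊢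
    linarith

lemma hybridSum_succ_left (φ : ℝ → ℝ) (m : ℕ) (X : ℕ → Bool) (n k : ℕ) :
    hybridSum φ m X (n + 1) k = ∑ y : Fin n → Bool,
      (constantSum φ m k (prefixCount X y + increment X false (prefixCount X y)) +
        constantSum φ m k (prefixCount X y + increment X true (prefixCount X y))) := by
  rw [hybridSum, ← (Fin.snocEquiv fun _ => Bool).sum_comp, Fintype.sum_prod_type_right]
  refine sum_congr rfl fun y _ => ?_
  rw [Fintype.sum_bool, add_comm, ← prefixCount_snoc, ← prefixCount_snoc]
  rfl

lemma hybridSum_succ_right (φ : ℝ → ℝ) (m : ℕ) (X : ℕ → Bool) (n k : ℕ) :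
    hybridSum φ m X n (k + 1) = ∑ y : Fin n → Bool,
      (constantSum φ m k (prefixCount X y) +
        constantSum φ m k (prefixCount X y + increment X false (prefixCount X y) +
          increment X true (prefixCount X y))) := by
  refine sum_congr rfl fun y _ => ?_
  rw [add_assoc, increment_false_add_true]
  rfl

lemma hybridSum_step (hφ : StrictConvexOn ℝ (Set.Ici 0) φ) (m : ℕ) (X : ℕ → Bool) (n k : ℕ) :
    hybridSum φ m X (n + 1) k ≤ hybridSum φ m X n (k + 1) := by
  rw [hybridSum_succ_left, hybridSum_succ_right]
  exact sum_le_sum fun y _ => constantSum_supermodular hφ m k (prefixCount_nonneg X y)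
    (increment_nonneg X _ (prefixCount_nonneg X y)) (increment_nonneg X _ (prefixCount_nonneg X y))

lemma prefixCount_self_pos (X : ℕ → Bool) {m j : ℕ} (hj : j ≤ m) :
    0 < prefixCount X (fun i : Fin m => X i) j := by
  rw [prefixCount, Nat.cast_pos, omega, Nat.card_pos_iff]
  exact ⟨⟨⟨Fin.castLE hj, Fin.strictMono_castLE hj, fun _ => rfl⟩⟩, inferInstance⟩

lemma hybridSum_step_strict (hφ : StrictConvexOn ℝ (Set.Ici 0) φ) {m k : ℕ} (X : ℕ → Bool)
    (hk : m ≤ k) (hfalse : ∃ i < m, X i = false) (htrue : ∃ i < m, X i = true) :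
    hybridSum φ m X (m + 1) k < hybridSum φ m X m (k + 1) := by
  rw [hybridSum_succ_left, hybridSum_succ_right]
  have hpos : ∀ b, (∃ i < m, X i = b) → ∃ i ≤ m, m ≤ i + k ∧
      0 < increment X b (prefixCount X (fun i : Fin m => X i)) i := by
    rintro b ⟨i, hi, hb⟩
    refine ⟨i + 1, hi, by omega, ?_⟩
    simpa [increment, hb] using prefixCount_self_pos X hi.le
  refine sum_lt_sum (fun y _ => constantSum_supermodular hφ m k (prefixCount_nonneg X y)
    (increment_nonneg X _ (prefixCount_nonneg X y))
    (increment_nonneg X _ (prefixCount_nonneg X y))) ⟨fun i => X i, mem_univ _, ?_⟩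
  exact constantSum_strict_supermodular hφ (prefixCount_nonneg X _)
    (increment_nonneg X _ (prefixCount_nonneg X _))
    (increment_nonneg X _ (prefixCount_nonneg X _)) (hpos _ hfalse) (hpos _ htrue)

lemma hybridSum_add_le (hφ : StrictConvexOn ℝ (Set.Ici 0) φ) (m : ℕ) (X : ℕ → Bool)
    (n k l : ℕ) : hybridSum φ m X (n + l) k ≤ hybridSum φ m X n (k + l) := by
  induction l generalizing k with
  | zero => exact le_rfl
  | succ l ih =>
    refine (hybridSum_step hφ m X (n + l) k).trans ((ih (k + 1)).trans_eq ?_)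
    rw [add_assoc, add_comm 1 l]

lemma hybridSum_const (φ : ℝ → ℝ) (m n k : ℕ) :
    hybridSum φ m (fun _ => false) n k = hybridSum φ m (fun _ => false) 0 (n + k) := by
  induction n generalizing k with
  | zero => rw [zero_add]
  | succ n ih =>
    have hinc : ∀ A, increment (fun _ => false) true A = 0 := by
      intro A
      funext j
      cases j <;> simp [increment]
    rw [add_assoc, add_comm 1 k, ← ih, hybridSum_succ_left, hybridSum_succ_right]
    refine sum_congr rfl fun y _ => ?_
    rw [hinc, add_zero, add_zero, add_comm]

lemma hybridSum_zero_left (φ : ℝ → ℝ) (m : ℕ) (X Y : ℕ → Bool) (k : ℕ) :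
    hybridSum φ m X 0 k = hybridSum φ m Y 0 k := by
  refine sum_congr rfl fun y _ => ?_
  congr 1
  funext j
  simp only [prefixCount, omega]
  congr 1
  refine Nat.card_congr (Equiv.subtypeEquivRight fun π => and_congr_right fun _ => ?_)
  exact forall_congr' fun i => (π i).elim0

end Supermodular

/-- The summand of the entropy, as a function of the number of embeddings. -/
lemma strictConvexOn_div_mul_logb_div {c : ℝ} (hc : 0 < c) :
    StrictConvexOn ℝ (Set.Ici 0) fun t : ℝ => t / c * Real.logb 2 (t / c) := by
  have hlog : 0 < Real.log 2 := Real.log_pos one_lt_two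
  refine ⟨convex_Ici 0, fun s hs t ht hne a b ha hb hab => ?_⟩
  have h := Real.strictConvexOn_mul_log.2 (x := s / c) (div_nonneg hs hc.le)
    (y := t / c) (div_nonneg ht hc.le)
    (fun h => hne ((div_left_inj' hc.ne').1 h)) ha hb hab
  have e : (a • s + b • t) / c = a • (s / c) + b • (t / c) := by
    simp only [smul_eq_mul]; ring
  simp only [e, Real.logb]
  have h' := div_lt_div_of_pos_right h hlog
  simp only [smul_eq_mul] at h' ⊢
  calc _ = _ := by ring
    _ < _ := h'
    _ = _ := by ring

lemma Hent_eq_neg_hybridSum (m n : ℕ) (X : ℕ → Bool) :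
    Hent m n (fun i => X i) =
      -hybridSum (fun t => t / (mu n m : ℝ) * Real.logb 2 (t / (mu n m : ℝ))) m X n 0 := rfl

/-- For every `m ≥ 1` there is an `N` such that for all `n > N` and every binary string
`x` of length `m`, `H_n(x) ≥ H_n(0^m)`, with equality only for the constant strings:
`H_n(x) > H_n(0^m)` whenever `x` is nonconstant. -/
theorem entropy_minimized_by_constant (m : ℕ) (hm : 0 < m) :
    ∃ N : ℕ, ∀ n : ℕ, n > N → ∀ x : Fin m → Bool,
      Hent m n (fun _ => false) ≤ Hent m n x ∧
      ((x ≠ fun _ => false) → (x ≠ fun _ => true) →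
        Hent m n (fun _ => false) < Hent m n x) := by
  refine ⟨2 * m, fun n hn x => ?_⟩
  have hmu : (0 : ℝ) < mu n m := by
    exact_mod_cast Nat.mul_pos (Nat.choose_pos (by omega)) (by positivity)
  have hφ := strictConvexOn_div_mul_logb_div hmu
  obtain ⟨X, rfl⟩ : ∃ X : ℕ → Bool, x = fun i : Fin m => X i :=
    ⟨fun i => if h : i < m then x ⟨i, h⟩ else false, by funext i; simp⟩
  have hconst := Hent_eq_neg_hybridSum m n (fun _ => false)
  rw [hybridSum_const, hybridSum_zero_left _ m _ X] at hconst
  rw [hconst, Hent_eq_neg_hybridSum]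
  refine ⟨neg_le_neg ?_, fun hfalse htrue => neg_lt_neg ?_⟩
  · simpa using hybridSum_add_le hφ m X 0 0 n
  · obtain ⟨i, hi⟩ := Function.ne_iff.1 htrue
    obtain ⟨j, hj⟩ := Function.ne_iff.1 hfalse
    obtain ⟨k, hk, rfl⟩ : ∃ k, m ≤ k ∧ n = m + 1 + k := ⟨n - (m + 1), by omega, by omega⟩
    have h1 := hybridSum_add_le hφ m X (m + 1) 0 k
    have h2 := hybridSum_step_strict hφ X hk ⟨i, i.2, by simpa using hi⟩
      ⟨j, j.2, by simpa using hj⟩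
    have h3 := hybridSum_add_le hφ m X 0 (k + 1) m
    rw [zero_add] at h1 h3
    rw [show m + 1 + k + 0 = k + 1 + m by omega]
    exact h1.trans_lt (h2.trans_le h3)
end
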